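/- For every ε > 0 there exist constants c_ε > 0 and c > 0 such that the following holds. Let p be a prime and let A ⊆ F_p with |A| ≤ c·p^{71/125}. Then |(A−A)² − (A−A)²| ≥ c_ε·p^{−ε}·|A|^{3/2 + 1/142}. -/

import Mathlib

open Finset Pointwise

namespace FpSumProd

/-- `A² = {a² : a ∈ A}`. -/
def sqSet {p : ℕ} (A : Finset (ZMod p)) : Finset (ZMod p) := A.image fun a => a ^ 2

/-- `A² - A² = {a² - b² : a, b ∈ A}` (here `A - B` denotes the pointwise difference set). -/
def sqDiff {p : ℕ} (A : Finset (ZMod p)) : Finset (ZMod p) := sqSet A - sqSet A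

section

open Polynomial in
theorem resultant_ne_zero {R : Type*} [CommRing R] [IsDomain R] [UniqueFactorizationMonoid R]
    {f g : R[X]} (hf : f ≠ 0) (h : IsRelPrime f g) : f.resultant g ≠ 0 := by
  intro h0
  obtain ⟨v, hv, hv0⟩ := Matrix.exists_mulVec_eq_zero_iff.2 h0
  let b₁ := ((degreeLT.basis R f.natDegree).prod (degreeLT.basis R g.natDegree)).reindex
    finSumFinEquiv
  let b₂ := degreeLT.basis R (f.natDegree + g.natDegree)
  obtain ⟨⟨⟨q, hq⟩, ⟨r, hr⟩⟩, hx⟩ := b₁.equivFun.surjective v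
  have key := LinearMap.toMatrix_mulVec_repr b₁ b₂ (sylvesterMap f g le_rfl le_rfl)
    (⟨q, hq⟩, ⟨r, hr⟩)
  rw [toMatrix_sylvesterMap'] at key
  have hx' : ⇑(b₁.repr (⟨q, hq⟩, ⟨r, hr⟩)) = v := hx
  rw [hx', hv0] at key
  have h1 : sylvesterMap f g le_rfl le_rfl (⟨q, hq⟩, ⟨r, hr⟩) = 0 := by
    apply b₂.repr.injective
    ext i
    simpa using (congrFun key i).symm
  have h2 : f * r + g * q = 0 := congrArg Subtype.val h1
  have hdvd : f ∣ q := by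
    refine h.dvd_of_dvd_mul_left ?_
    exact ⟨-r, by linear_combination h2⟩
  have hq0 : q = 0 := by
    refine eq_zero_of_dvd_of_degree_lt hdvd ?_
    rw [degree_eq_natDegree hf]
    exact mem_degreeLT.1 hq
  subst hq0
  have hr0 : r = 0 := by
    simpa [hf] using h2
  subst hr0
  apply hv
  rw [← hx]
  exact b₁.equivFun.map_zero

variable {F : Type*} [Field F]

/-- The coefficients of a polynomial in the first variable have controlled total degree. -/
theorem totalDegree_coeff_finSuccEquiv_le {n : ℕ} (f : MvPolynomial (Fin (n + 1)) F) (i : ℕ) :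
    ((MvPolynomial.finSuccEquiv F n f).coeff i).totalDegree ≤ f.totalDegree := by
  by_cases h : (MvPolynomial.finSuccEquiv F n f).coeff i = 0
  · simp [h]
  · have := MvPolynomial.totalDegree_coeff_finSuccEquiv_add_le f i h
    omega

theorem natDegree_finSuccEquiv_le {n : ℕ} (f : MvPolynomial (Fin (n + 1)) F) :
    (MvPolynomial.finSuccEquiv F n f).natDegree ≤ f.totalDegree := by
  rw [MvPolynomial.natDegree_finSuccEquiv]
  exact MvPolynomial.degreeOf_le_totalDegree f 0

theorem totalDegree_resultant_finSuccEquiv_le {n : ℕ} (f g : MvPolynomial (Fin (n + 1)) F) :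
    ((MvPolynomial.finSuccEquiv F n f).resultant (MvPolynomial.finSuccEquiv F n g)).totalDegree ≤
      2 * (f.totalDegree * g.totalDegree) := by
  set P := MvPolynomial.finSuccEquiv F n f
  set Q := MvPolynomial.finSuccEquiv F n g
  rw [Polynomial.resultant, Matrix.det_apply]
  refine MvPolynomial.totalDegree_finsetSum_le fun σ _ => ?_
  refine (MvPolynomial.totalDegree_smul_le _ _).trans ?_
  refine (MvPolynomial.totalDegree_finsetProd _ _).trans ?_
  rw [Fin.sum_univ_add]
  have h1 : ∀ i j, ((P.sylvester Q P.natDegree Q.natDegree) i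
      (Fin.castAdd _ j)).totalDegree ≤ g.totalDegree := by
    intro i j
    simp only [Polynomial.sylvester, Matrix.of_apply, Fin.addCases_left]
    split_ifs
    · exact totalDegree_coeff_finSuccEquiv_le g _
    · simp
  have h2 : ∀ i j, ((P.sylvester Q P.natDegree Q.natDegree) i
      (Fin.natAdd _ j)).totalDegree ≤ f.totalDegree := by
    intro i j
    simp only [Polynomial.sylvester, Matrix.of_apply, Fin.addCases_right]
    split_ifs
    · exact totalDegree_coeff_finSuccEquiv_le f _
    · simp
  refine (add_le_add (Finset.sum_le_sum fun i _ => h1 _ i)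
    (Finset.sum_le_sum fun i _ => h2 _ i)).trans ?_
  simp only [Finset.sum_const, Finset.card_univ, Fintype.card_fin, smul_eq_mul]
  have h3 : P.natDegree ≤ f.totalDegree := natDegree_finSuccEquiv_le f
  have h4 : Q.natDegree ≤ g.totalDegree := natDegree_finSuccEquiv_le g
  nlinarith [Nat.mul_le_mul_right g.totalDegree h3, Nat.mul_le_mul_right f.totalDegree h4]

/-- Restriction of a planar polynomial to the line `u = y + x τ`. -/
noncomputable def planeRes (x y : F) : MvPolynomial (Fin 2) F →ₐ[F] Polynomial F :=
  MvPolynomial.aeval ![Polynomial.C y + Polynomial.C x * Polynomial.X, Polynomial.X]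

theorem coeff_linear_pow_mul (x y : F) (i j D : ℕ) (h : i + j ≤ D) :
    ((Polynomial.C y + Polynomial.C x * Polynomial.X) ^ i * Polynomial.X ^ j).coeff D =
      if i + j = D then x ^ i else 0 := by
  rw [Polynomial.coeff_mul_X_pow', if_pos (by omega)]
  have hd : (Polynomial.C y + Polynomial.C x * Polynomial.X).natDegree ≤ 1 := by compute_degree
  split_ifs with hD
  · have := Polynomial.coeff_pow_of_natDegree_le (m := i) (n := 1) hd
    rw [mul_one] at this
    rw [show D - j = i by omega, this]
    simp
  · apply Polynomial.coeff_eq_zero_of_natDegree_lt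
    have := Polynomial.natDegree_pow_le_of_le i hd
    omega

/-- A nonzero planar polynomial vanishes on few lines with pairwise distinct slopes. -/
theorem card_planeRes_eq_zero_le {ι : Type*} {c : MvPolynomial (Fin 2) F} (hc : c ≠ 0)
    (L : Finset ι) (x y : ι → F) (hx : Set.InjOn x L)
    (h : ∀ l ∈ L, planeRes (x l) (y l) c = 0) : L.card ≤ c.totalDegree := by
  classical
  set D := c.totalDegree with hD
  let q : Polynomial F := ∑ m ∈ c.support,
    if m 0 + m 1 = D then Polynomial.C (c.coeff m) * Polynomial.X ^ (m 0) else 0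
  have hdeg : ∀ m ∈ c.support, m 0 + m 1 ≤ D := by
    intro m hm
    have := MvPolynomial.le_totalDegree hm
    rw [Finsupp.sum_fintype _ _ (by simp)] at this
    simpa [Fin.sum_univ_two] using this
  have hroot : ∀ l ∈ L, q.eval (x l) = 0 := by
    intro l hl
    have h0 := congrArg (fun r => Polynomial.coeff r D) (h l hl)
    simp only [planeRes, MvPolynomial.aeval_def, MvPolynomial.eval₂_eq', Fin.prod_univ_two,
      Polynomial.finsetSum_coeff, Polynomial.coeff_zero] at h0
    rw [← h0, Polynomial.eval_finsetSum]
    refine Finset.sum_congr rfl fun m hm => ?_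
    simp only [Matrix.cons_val_zero, Matrix.cons_val_one, Polynomial.algebraMap_eq,
      Polynomial.coeff_C_mul]
    rw [coeff_linear_pow_mul _ _ _ _ _ (hdeg m hm)]
    split_ifs <;> simp
  have hq : q ≠ 0 := by
    obtain ⟨m, hm, hmD⟩ : ∃ m ∈ c.support, m 0 + m 1 = D := by
      obtain ⟨m, hm, hmD⟩ := Finset.exists_mem_eq_sup c.support
        (MvPolynomial.support_nonempty.2 hc) (fun s => s.sum fun _ e => e)
      refine ⟨m, hm, ?_⟩
      have : D = m.sum fun _ e => e := hmD
      rw [this, Finsupp.sum_fintype _ _ (by simp)]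
      simp [Fin.sum_univ_two]
    intro h0
    have h1 := congrArg (fun r => Polynomial.coeff r (m 0)) h0
    simp only [q, Polynomial.finsetSum_coeff, Polynomial.coeff_zero] at h1
    rw [Finset.sum_eq_single m] at h1
    · simp [hmD] at h1
      exact (MvPolynomial.mem_support_iff.1 hm) h1
    · intro m' hm' hne
      split_ifs with h2
      · rw [Polynomial.coeff_C_mul_X_pow, if_neg]
        intro h3
        apply hne
        ext i
        fin_cases i
        · exact h3.symm
        · show m' 1 = m 1
          omega
      · simp
    · intro h2
      exact absurd hm h2
  have hqd : q.natDegree ≤ D := by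
    refine Polynomial.natDegree_sum_le_of_forall_le _ _ fun m hm => ?_
    split_ifs
    · refine (Polynomial.natDegree_C_mul_X_pow_le _ _).trans ?_
      have := hdeg m hm
      omega
    · simp
  by_contra hlt
  push Not at hlt
  apply hq
  refine Polynomial.eq_zero_of_natDegree_lt_card_of_eval_eq_zero' q (L.image x) ?_ ?_
  · intro z hz
    obtain ⟨l, hl, rfl⟩ := Finset.mem_image.1 hz
    exact hroot l hl
  · rw [Finset.card_image_of_injOn hx]
    omega

end

section

variable {F : Type*} [Field F]

/-- The line `τ ↦ (v, u, τ) = (w + x² τ, y + x τ, τ)` in three-space. -/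
structure LightLine (F : Type*) where
  /-- the slope -/
  x : F
  /-- the constant term of the second coordinate -/
  y : F
  /-- the constant term of the first coordinate -/
  w : F

namespace LightLine

/-- Restriction of a polynomial in `(v, u, τ)` to a light line. -/
noncomputable def res (l : LightLine F) : MvPolynomial (Fin 3) F →ₐ[F] Polynomial F :=
  MvPolynomial.aeval ![Polynomial.C l.w + Polynomial.C (l.x ^ 2) * Polynomial.X,
    Polynomial.C l.y + Polynomial.C l.x * Polynomial.X, Polynomial.X]

/-- Two light lines of distinct slopes have a common point. -/
def Meets (s t : LightLine F) : Prop :=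
  s.x ≠ t.x ∧ t.w - s.w = (s.x + t.x) * (t.y - s.y)

/-- The parameter of the common point of two light lines which meet. -/
noncomputable def meetParam (s t : LightLine F) : F := (t.y - s.y) / (s.x - t.x)

theorem natDegree_res_le (l : LightLine F) (f : MvPolynomial (Fin 3) F) :
    (l.res f).natDegree ≤ f.totalDegree := by
  rw [res, MvPolynomial.aeval_def, MvPolynomial.eval₂_eq']
  refine Polynomial.natDegree_sum_le_of_forall_le _ _ fun m hm => ?_
  have h0 : (Polynomial.C l.w + Polynomial.C (l.x ^ 2) * Polynomial.X).natDegree ≤ 1 := by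
    compute_degree
  have h1 : (Polynomial.C l.y + Polynomial.C l.x * Polynomial.X).natDegree ≤ 1 := by
    compute_degree
  have hm := MvPolynomial.le_totalDegree hm
  rw [Finsupp.sum_fintype _ _ (by simp), Fin.sum_univ_three] at hm
  rw [Fin.prod_univ_three, Polynomial.algebraMap_eq]
  refine (Polynomial.natDegree_C_mul_le _ _).trans ?_
  refine Polynomial.natDegree_mul_le.trans ?_
  refine (add_le_add Polynomial.natDegree_mul_le le_rfl).trans ?_
  have a0 := Polynomial.natDegree_pow_le_of_le (m 0) h0
  have a1 := Polynomial.natDegree_pow_le_of_le (m 1) h1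
  have a2 := Polynomial.natDegree_pow_le_of_le (m 2) (Polynomial.natDegree_X_le (R := F))
  simp only [Matrix.cons_val]
  omega

theorem eval_res (l : LightLine F) (f : MvPolynomial (Fin 3) F) (a : F) :
    (l.res f).eval a = MvPolynomial.eval ![l.w + l.x ^ 2 * a, l.y + l.x * a, a] f := by
  have : (Polynomial.aeval a).comp l.res =
      MvPolynomial.aeval ![l.w + l.x ^ 2 * a, l.y + l.x * a, a] := by
    apply MvPolynomial.algHom_ext
    intro i
    fin_cases i <;> simp [res]
  have h := DFunLike.congr_fun this f
  simpa [Polynomial.coe_aeval_eq_eval, MvPolynomial.aeval_eq_eval] using h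

theorem Meets.sub_ne_zero {s t : LightLine F} (h : Meets s t) : s.x - t.x ≠ 0 :=
  _root_.sub_ne_zero.2 h.1

theorem Meets.eval_res_eq {s t : LightLine F} (h : Meets s t) (f : MvPolynomial (Fin 3) F) :
    (s.res f).eval (meetParam s t) = (t.res f).eval (meetParam s t) := by
  have h1 := h.sub_ne_zero
  have hτ : (s.x - t.x) * meetParam s t = t.y - s.y := by
    rw [meetParam]; field_simp
  rw [eval_res, eval_res]
  have e1 : s.w + s.x ^ 2 * meetParam s t = t.w + t.x ^ 2 * meetParam s t := by
    linear_combination (s.x + t.x) * hτ - h.2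
  have e2 : s.y + s.x * meetParam s t = t.y + t.x * meetParam s t := by
    linear_combination hτ
  rw [e1, e2]

/-- No two lines of the family have a common point. -/
def Skew (S : Finset (LightLine F)) : Prop :=
  ∀ s ∈ S, ∀ t ∈ S, s ≠ t → t.w - s.w ≠ (s.x + t.x) * (t.y - s.y)

theorem Skew.meetParam_injOn {S N : Finset (LightLine F)} (hS : Skew S) (hN : N ⊆ S)
    (t : LightLine F) (h : ∀ s ∈ N, Meets s t) : Set.InjOn (fun s => meetParam s t) N := by
  intro s hs s' hs' he
  by_contra hne
  refine hS s (hN hs) s' (hN hs') hne ?_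
  have a1 := (h s hs).sub_ne_zero
  have a2 := (h s' hs').sub_ne_zero
  have b1 : (s.x - t.x) * meetParam s t = t.y - s.y := by
    rw [meetParam]; field_simp
  have b2 : (s'.x - t.x) * meetParam s t = t.y - s'.y := by
    simp only at he
    rw [he, meetParam]; field_simp
  linear_combination (h s hs).2 - (h s' hs').2 - (t.x - s'.x) * b1 - (s.x - t.x) * b2

theorem eq_zero_of_meets {S N : Finset (LightLine F)} (hS : Skew S) (hN : N ⊆ S)
    (t : LightLine F) (h : ∀ s ∈ N, Meets s t) (q : Polynomial F)
    (hq : ∀ s ∈ N, q.eval (meetParam s t) = 0) (hd : q.natDegree < N.card) : q = 0 := by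
  classical
  refine Polynomial.eq_zero_of_natDegree_lt_card_of_eval_eq_zero' q
    (N.image fun s => meetParam s t) ?_ ?_
  · intro z hz
    obtain ⟨l, hl, rfl⟩ := Finset.mem_image.1 hz
    exact hq l hl
  · rwa [Finset.card_image_of_injOn (hS.meetParam_injOn hN t h)]

theorem res_comp_finSuccEquiv_symm_C (l : LightLine F) (c : MvPolynomial (Fin 2) F) :
    l.res ((MvPolynomial.finSuccEquiv F 2).symm (Polynomial.C c)) = planeRes l.x l.y c := by
  have : (l.res.comp ((MvPolynomial.finSuccEquiv F 2).symm : _ →ₐ[F] _)).comp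
      (IsScalarTower.toAlgHom F (MvPolynomial (Fin 2) F)
        (Polynomial (MvPolynomial (Fin 2) F))) = planeRes l.x l.y := by
    apply MvPolynomial.algHom_ext
    intro i
    have : (MvPolynomial.finSuccEquiv F 2).symm (Polynomial.C (MvPolynomial.X i)) =
        MvPolynomial.X i.succ := by
      rw [AlgEquiv.symm_apply_eq, MvPolynomial.finSuccEquiv_X_succ]
    simp only [AlgHom.comp_apply, IsScalarTower.toAlgHom_apply, Polynomial.algebraMap_apply,
      Algebra.algebraMap_self, RingHom.id_apply]
    change l.res ((MvPolynomial.finSuccEquiv F 2).symm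
      (Polynomial.C (MvPolynomial.X i))) = _
    rw [this]
    fin_cases i <;> simp [res, planeRes]
  exact DFunLike.congr_fun this c

/-- Two relatively prime polynomials vanish on few common light lines of distinct slopes. -/
theorem card_res_eq_zero_le {f g : MvPolynomial (Fin 3) F} (hf : f ≠ 0)
    (h : IsRelPrime f g) (L : Finset (LightLine F))
    (hx : Set.InjOn LightLine.x (L : Set (LightLine F)))
    (hLf : ∀ l ∈ L, l.res f = 0) (hLg : ∀ l ∈ L, l.res g = 0) :
    L.card ≤ 2 * (f.totalDegree * g.totalDegree) := by
  let E := MvPolynomial.finSuccEquiv F 2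
  have hEf : E f ≠ 0 := by simpa using hf
  have hrel : IsRelPrime (E f) (E g) := by
    intro d h1 h2
    have h1' : E.symm d ∣ f := by simpa using map_dvd E.symm h1
    have h2' : E.symm d ∣ g := by simpa using map_dvd E.symm h2
    have := (h h1' h2').map E
    simpa using this
  by_cases h00 : (E f).natDegree = 0 ∧ (E g).natDegree = 0
  · obtain ⟨c, hc⟩ := Polynomial.natDegree_eq_zero.1 h00.1
    have hc0 : c ≠ 0 := by
      rintro rfl
      exact hEf (by simp [← hc])
    by_cases hg : g.totalDegree = 0
    · rw [MvPolynomial.totalDegree_eq_zero_iff_eq_C] at hg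
      rcases L.eq_empty_or_nonempty with rfl | ⟨l, hl⟩
      · simp
      have h2 := hLg l hl
      rw [hg] at h2
      simp only [res, MvPolynomial.aeval_C, Polynomial.algebraMap_eq, Polynomial.C_eq_zero] at h2
      rw [h2, MvPolynomial.C_0] at hg
      rw [hg, isRelPrime_zero_right] at h
      obtain ⟨a, -, ha⟩ := MvPolynomial.isUnit_iff_eq_C_of_isReduced.1 h
      have h3 := hLf l hl
      rw [ha] at h3 hf
      simp only [res, MvPolynomial.aeval_C, Polynomial.algebraMap_eq, Polynomial.C_eq_zero] at h3
      simp [h3] at hf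
    · have h1 := card_planeRes_eq_zero_le hc0 L LightLine.x LightLine.y hx (fun l hl => by
        rw [← res_comp_finSuccEquiv_symm_C, hc]
        simpa [E] using hLf l hl)
      have h2 : c.totalDegree ≤ f.totalDegree := by
        have := totalDegree_coeff_finSuccEquiv_le f 0
        change ((E f).coeff 0).totalDegree ≤ _ at this
        rwa [← hc, Polynomial.coeff_C_zero] at this
      have : 1 ≤ g.totalDegree := by omega
      nlinarith
  · obtain ⟨a, b, -, -, hab⟩ := Polynomial.exists_mul_add_mul_eq_C_resultant (E f) (E g)
      le_rfl le_rfl (by tauto)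
    refine (card_planeRes_eq_zero_le (resultant_ne_zero hEf hrel) L LightLine.x LightLine.y hx
      (fun l hl => ?_)).trans (totalDegree_resultant_finSuccEquiv_le f g)
    rw [← res_comp_finSuccEquiv_symm_C, ← hab, map_add, map_mul, map_mul, map_add, map_mul,
      map_mul]
    change l.res (E.symm (E f)) * _ + l.res (E.symm (E g)) * _ = 0
    rw [AlgEquiv.symm_apply_apply, AlgEquiv.symm_apply_apply, hLf l hl, hLg l hl]
    simp

end LightLine

end

section

variable {F : Type*} [Field F]

section Derivations

open MvPolynomial

theorem totalDegree_pderiv_le {σ : Type*} (i : σ) (f : MvPolynomial σ F) :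
    (pderiv i f).totalDegree ≤ f.totalDegree := by
  classical
  conv_lhs => rw [f.as_sum]
  rw [map_sum]
  refine totalDegree_finsetSum_le fun m hm => ?_
  rw [pderiv_monomial]
  refine (totalDegree_monomial_le _ _).trans ?_
  refine le_trans ?_ (le_totalDegree hm)
  exact Finsupp.sum_le_sum_index tsub_le_self (fun _ _ _ _ h => h) (fun _ _ => rfl)

theorem pderiv_comm {σ : Type*} (i j : σ) (f : MvPolynomial σ F) :
    pderiv i (pderiv j f) = pderiv j (pderiv i f) := by
  classical
  have : ⁅pderiv (R := F) i, pderiv (R := F) j⁆ = 0 := by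
    apply derivation_ext
    intro k
    simp [Derivation.commutator_apply, pderiv_X, Pi.single_apply, apply_ite]
  have h := DFunLike.congr_fun this f
  simpa [Derivation.commutator_apply, sub_eq_zero] using h

theorem finSuccEquiv_pderiv_zero {n : ℕ} (f : MvPolynomial (Fin (n + 1)) F) :
    finSuccEquiv F n (pderiv 0 f) = Polynomial.derivative (finSuccEquiv F n f) := by
  induction f using MvPolynomial.induction_on with
  | C a => simp [finSuccEquiv_apply]
  | add f g hf hg => simp [hf, hg]
  | mul_X f i hf =>
    rw [pderiv_mul, map_add, map_mul, map_mul, map_mul, hf, Polynomial.derivative_mul]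
    have hX : finSuccEquiv F n (pderiv 0 (X i)) =
        Polynomial.derivative (finSuccEquiv F n (X i)) := by
      refine Fin.cases ?_ (fun j => ?_) i
      · rw [pderiv_X_self, finSuccEquiv_X_zero, Polynomial.derivative_X, map_one]
      · rw [pderiv_X_of_ne (Fin.succ_ne_zero j), finSuccEquiv_X_succ, Polynomial.derivative_C,
          map_zero]
    rw [hX]

theorem natDegree_eq_zero_of_derivative {R : Type*} [CommRing R] [IsDomain R] (p : ℕ)
    [CharP R p] (q : Polynomial R) (h : Polynomial.derivative q = 0) (hd : q.natDegree < p) :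
    q.natDegree = 0 := by
  by_contra h0
  have h1 := congrArg (fun r => r.coeff (q.natDegree - 1)) h
  simp only [Polynomial.coeff_derivative, Polynomial.coeff_zero] at h1
  rw [show q.natDegree - 1 + 1 = q.natDegree by omega, mul_eq_zero] at h1
  rcases h1 with h1 | h1
  · have : q = 0 := Polynomial.leadingCoeff_eq_zero.1 h1
    simp [this] at h0
  · have h2 : ((q.natDegree : ℕ) : R) = 0 := by
      have : ((q.natDegree - 1 + 1 : ℕ) : R) = 0 := by push_cast; exact h1
      rwa [show q.natDegree - 1 + 1 = q.natDegree by omega] at this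
    rw [CharP.cast_eq_zero_iff R p] at h2
    exact absurd (Nat.le_of_dvd (by omega) h2) (by omega)

/-- The derivative along the direction of a light line of slope `x`. -/
noncomputable def dirDeriv (x : F) : Derivation F (MvPolynomial (Fin 3) F)
    (MvPolynomial (Fin 3) F) :=
  pderiv 2 + x • pderiv 1 + (x ^ 2) • pderiv 0

theorem LightLine.derivative_res (l : LightLine F) (f : MvPolynomial (Fin 3) F) :
    Polynomial.derivative (l.res f) = l.res (dirDeriv l.x f) := by
  induction f using MvPolynomial.induction_on with
  | C a => simp [res, dirDeriv]
  | add f g hf hg => simp [hf, hg]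
  | mul_X f i hf =>
    rw [map_mul, Polynomial.derivative_mul, hf, Derivation.leibniz, map_add, smul_eq_mul,
      smul_eq_mul, map_mul, map_mul, add_comm, mul_comm (l.res (X i))]
    congr 2
    fin_cases i
    · simp [res, dirDeriv, MvPolynomial.smul_eq_C_mul, Polynomial.derivative_pow]
    · simp [res, dirDeriv, MvPolynomial.smul_eq_C_mul]
    · simp [res, dirDeriv]

end Derivations

section Wronskian

open Polynomial

/-- Two polynomials of small degree with vanishing Wronskian are proportional. -/
theorem eq_C_mul_of_wronskian_eq_zero (p : ℕ) [CharP F p] {f g : F[X]} (hg : g ≠ 0)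
    (hgd : g.natDegree < p) (hfd : f.natDegree < p)
    (h : derivative f * g = f * derivative g) : ∃ b : F, f = C b * g := by
  have main : ∀ q : F[X], q ≠ 0 → q.natDegree < p → derivative q * g = q * derivative g →
      q.natDegree = g.natDegree := by
    intro q hq hqd hw
    have h1 := congrArg (fun r => r.coeff (q.natDegree + g.natDegree - 1)) hw
    by_cases hz : q.natDegree + g.natDegree = 0
    · omega
    have lead : ∀ a b : F[X], (derivative a * b).coeff (a.natDegree + b.natDegree - 1) =
        (a.natDegree : F) * a.leadingCoeff * b.leadingCoeff := by
      intro a b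
      by_cases ha : a.natDegree = 0
      · obtain ⟨c, rfl⟩ := natDegree_eq_zero.1 ha
        simp
      · have e : a.natDegree + b.natDegree - 1 = (a.natDegree - 1) + b.natDegree := by omega
        rw [e, coeff_mul_add_eq_of_natDegree_le (natDegree_derivative_le a) le_rfl,
            coeff_derivative,
          show a.natDegree - 1 + 1 = a.natDegree by omega]
        have : ((a.natDegree - 1 : ℕ) : F) + 1 = a.natDegree := by
          rw [Nat.cast_sub (by omega)]; simp
        rw [this, leadingCoeff, leadingCoeff]
        ring
    rw [lead, mul_comm q, add_comm q.natDegree, lead] at h1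
    have h2 : ((q.natDegree : F) - g.natDegree) * (q.leadingCoeff * g.leadingCoeff) = 0 := by
      linear_combination h1
    have h3 : (q.natDegree : F) = g.natDegree := by
      rcases mul_eq_zero.1 h2 with h3 | h3
      · exact sub_eq_zero.1 h3
      · simp [hq, hg] at h3
    rw [CharP.natCast_eq_natCast F p] at h3
    exact (Nat.ModEq.eq_of_lt_of_lt h3 hqd hgd)
  by_cases hf : f = 0
  · exact ⟨0, by simp [hf]⟩
  have hfg := main f hf hfd h
  refine ⟨f.leadingCoeff / g.leadingCoeff, ?_⟩
  have hgl : g.leadingCoeff ≠ 0 := by simpa using hg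
  set b := f.leadingCoeff / g.leadingCoeff
  by_contra hne
  have hq : f - C b * g ≠ 0 := sub_ne_zero.2 hne
  have hlt : (f - C b * g).degree < f.degree := by
    have hb : b ≠ 0 := div_ne_zero (by simpa using hf) hgl
    apply degree_sub_lt_left
    · rw [degree_C_mul hb, degree_eq_natDegree hf, degree_eq_natDegree hg, hfg]
    · exact hf
    · simp [b, hgl]
  have hlt' : (f - C b * g).natDegree < f.natDegree := natDegree_lt_natDegree hq hlt
  have := main (f - C b * g) hq (by omega) (by
    simp only [derivative_sub, derivative_C_mul]
    linear_combination h)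
  omega

/-- The differential equation satisfied along a ruling. -/
theorem exists_eq_linear_mul (p : ℕ) [CharP F p] {a c : F[X]} {d : ℕ} (hd : 2 * d < p)
    (hd1 : 1 ≤ d)
    (ha : a.natDegree ≤ d) (hc : c.natDegree ≤ d) (hc0 : c ≠ 0)
    (h : c * (c * derivative (derivative a) - a * derivative (derivative c)) =
      2 * derivative c * (c * derivative a - a * derivative c)) :
    ∃ α β : F, a = (C α + C β * X) * c := by
  have hda := natDegree_derivative_le a
  have hdc := natDegree_derivative_le c
  have hW : (c * derivative a - a * derivative c).natDegree < p := by
    refine lt_of_le_of_lt (natDegree_sub_le _ _) (max_lt ?_ ?_)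
    · exact lt_of_le_of_lt natDegree_mul_le (by omega)
    · exact lt_of_le_of_lt natDegree_mul_le (by omega)
  obtain ⟨β, hβ⟩ := eq_C_mul_of_wronskian_eq_zero p (f := c * derivative a - a * derivative c)
    (g := c ^ 2) (pow_ne_zero 2 hc0) (lt_of_le_of_lt natDegree_pow_le (by omega)) hW (by
      simp only [derivative_sub, derivative_mul, derivative_pow]
      simp only [Nat.cast_ofNat, map_ofNat]
      linear_combination c * h)
  have hX : (C β * X * c).natDegree ≤ d + 1 := by
    refine natDegree_mul_le.trans ?_
    have : (C β * X).natDegree ≤ 1 := by compute_degree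
    omega
  obtain ⟨α, hα⟩ := eq_C_mul_of_wronskian_eq_zero p (f := a - C β * X * c) (g := c) hc0
    (by omega) (lt_of_le_of_lt (natDegree_sub_le _ _) (max_lt (by omega) (by omega))) (by
      simp only [derivative_sub, derivative_mul, derivative_C, derivative_X]
      linear_combination hβ)
  exact ⟨α, β, by linear_combination hα⟩

end Wronskian

end

section

open LightLine
variable {F : Type*} [Field F]
open MvPolynomial

theorem dirDeriv_apply (x : F) (f : MvPolynomial (Fin 3) F) :
    dirDeriv x f = pderiv 2 f + C x * pderiv 1 f + C x ^ 2 * pderiv 0 f := by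
  simp [dirDeriv, MvPolynomial.smul_eq_C_mul]

/-- The constant coefficient of the quotient of the second order tangency polynomial
by the first order one. -/
noncomputable def tangencyQuot (g : MvPolynomial (Fin 3) F) : MvPolynomial (Fin 3) F :=
  pderiv 0 g ^ 2 * (2 * pderiv 0 (pderiv 2 g) + pderiv 1 (pderiv 1 g)) -
    2 * (pderiv 0 g * pderiv 1 g * pderiv 0 (pderiv 1 g)) +
    pderiv 1 g ^ 2 * pderiv 0 (pderiv 0 g) -
    pderiv 2 g * pderiv 0 g * pderiv 0 (pderiv 0 g)

/-- The constant coefficient of the remainder of the tangency polynomials. -/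
noncomputable def tangencyRem₀ (g : MvPolynomial (Fin 3) F) : MvPolynomial (Fin 3) F :=
  pderiv 0 g ^ 3 * pderiv 2 (pderiv 2 g) - tangencyQuot g * pderiv 2 g

/-- The linear coefficient of the remainder of the tangency polynomials. -/
noncomputable def tangencyRem₁ (g : MvPolynomial (Fin 3) F) : MvPolynomial (Fin 3) F :=
  2 * (pderiv 0 g ^ 3 * pderiv 1 (pderiv 2 g)) - tangencyQuot g * pderiv 1 g -
    (2 * (pderiv 0 g ^ 2 * pderiv 0 (pderiv 1 g)) -
      pderiv 0 (pderiv 0 g) * pderiv 1 g * pderiv 0 g) * pderiv 2 g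

section degrees

variable {σ : Type*} {a b : MvPolynomial σ F} {m n : ℕ}

theorem totalDegree_mul_le_of_le (ha : a.totalDegree ≤ m) (hb : b.totalDegree ≤ n) :
    (a * b).totalDegree ≤ m + n :=
  (totalDegree_mul a b).trans (add_le_add ha hb)

theorem totalDegree_add_le_of_le (ha : a.totalDegree ≤ n) (hb : b.totalDegree ≤ n) :
    (a + b).totalDegree ≤ n :=
  (totalDegree_add a b).trans (max_le ha hb)

theorem totalDegree_sub_le_of_le (ha : a.totalDegree ≤ n) (hb : b.totalDegree ≤ n) :
    (a - b).totalDegree ≤ n :=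
  (totalDegree_sub a b).trans (max_le ha hb)

theorem totalDegree_pow_le_of_le (k : ℕ) (ha : a.totalDegree ≤ m) :
    (a ^ k).totalDegree ≤ k * m :=
  (totalDegree_pow a k).trans (Nat.mul_le_mul_left k ha)

theorem totalDegree_two_mul_le_of_le (ha : a.totalDegree ≤ n) : (2 * a).totalDegree ≤ n := by
  rw [two_mul]
  exact totalDegree_add_le_of_le ha ha

theorem totalDegree_pderiv_le_of_le (i : σ) (ha : a.totalDegree ≤ n) :
    (pderiv i a).totalDegree ≤ n :=
  (totalDegree_pderiv_le i a).trans ha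

end degrees

theorem totalDegree_tangencyQuot_le (g : MvPolynomial (Fin 3) F) :
    (tangencyQuot g).totalDegree ≤ 3 * g.totalDegree := by
  have h : ∀ i, (pderiv i g).totalDegree ≤ g.totalDegree := fun i => totalDegree_pderiv_le i g
  have h' : ∀ i j, (pderiv i (pderiv j g)).totalDegree ≤ g.totalDegree := fun i j =>
    totalDegree_pderiv_le_of_le i (h j)
  rw [tangencyQuot, show 3 * g.totalDegree = 2 * g.totalDegree + g.totalDegree by ring]
  refine totalDegree_sub_le_of_le (totalDegree_add_le_of_le (totalDegree_sub_le_of_le ?_ ?_) ?_) ?_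
  · exact totalDegree_mul_le_of_le (totalDegree_pow_le_of_le 2 (h 0))
      (totalDegree_add_le_of_le (totalDegree_two_mul_le_of_le (h' _ _)) (h' _ _))
  · rw [two_mul g.totalDegree]
    exact totalDegree_two_mul_le_of_le (totalDegree_mul_le_of_le
      (totalDegree_mul_le_of_le (h _) (h _)) (h' _ _))
  · exact totalDegree_mul_le_of_le (totalDegree_pow_le_of_le 2 (h _)) (h' _ _)
  · rw [two_mul g.totalDegree]
    exact totalDegree_mul_le_of_le (totalDegree_mul_le_of_le (h _) (h _)) (h' _ _)

theorem totalDegree_tangencyRem₀_le (g : MvPolynomial (Fin 3) F) :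
    (tangencyRem₀ g).totalDegree ≤ 4 * g.totalDegree := by
  rw [tangencyRem₀, show 4 * g.totalDegree = 3 * g.totalDegree + g.totalDegree by ring]
  exact totalDegree_sub_le_of_le
    (totalDegree_mul_le_of_le (totalDegree_pow_le_of_le 3 (totalDegree_pderiv_le _ _))
      (totalDegree_pderiv_le_of_le _ (totalDegree_pderiv_le _ _)))
    (totalDegree_mul_le_of_le (totalDegree_tangencyQuot_le g) (totalDegree_pderiv_le _ _))

theorem totalDegree_tangencyRem₁_le (g : MvPolynomial (Fin 3) F) :
    (tangencyRem₁ g).totalDegree ≤ 4 * g.totalDegree := by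
  have h : ∀ i, (pderiv i g).totalDegree ≤ g.totalDegree := fun i => totalDegree_pderiv_le i g
  have h' : ∀ i j, (pderiv i (pderiv j g)).totalDegree ≤ g.totalDegree := fun i j =>
    totalDegree_pderiv_le_of_le i (h j)
  rw [tangencyRem₁, show 4 * g.totalDegree = 3 * g.totalDegree + g.totalDegree by ring]
  refine totalDegree_sub_le_of_le (totalDegree_sub_le_of_le ?_ ?_)
    (totalDegree_mul_le_of_le ?_ (h _))
  · exact totalDegree_two_mul_le_of_le
      (totalDegree_mul_le_of_le (totalDegree_pow_le_of_le 3 (h _)) (h' _ _))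
  · exact totalDegree_mul_le_of_le (totalDegree_tangencyQuot_le g) (h _)
  · rw [show 3 * g.totalDegree = 2 * g.totalDegree + g.totalDegree by ring]
    refine totalDegree_sub_le_of_le (totalDegree_two_mul_le_of_le
      (totalDegree_mul_le_of_le (totalDegree_pow_le_of_le 2 (h _)) (h' _ _))) ?_
    rw [two_mul]
    exact totalDegree_mul_le_of_le (totalDegree_mul_le_of_le (h' _ _) (h _)) (h _)

/-- The combination of the tangency remainders adapted to a direction. -/
theorem tangencyRem_eq (g : MvPolynomial (Fin 3) F) (x : F) :
    ∃ B : MvPolynomial (Fin 3) F,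
      tangencyRem₀ g + C x * tangencyRem₁ g =
        pderiv 0 g ^ 3 * dirDeriv x (dirDeriv x g) - dirDeriv x g * B ∧
      ∃ B', tangencyRem₁ g =
        2 * (pderiv 0 g ^ 3 * dirDeriv x (pderiv 1 g + C (2 * x) * pderiv 0 g)) -
          (pderiv 1 g + C (2 * x) * pderiv 0 g) * B - dirDeriv x g * B' := by
  have h2 : (C (2 : F) : MvPolynomial (Fin 3) F) = 2 := map_ofNat C 2
  have hp2 : ∀ i : Fin 3, pderiv i (2 : MvPolynomial (Fin 3) F) = 0 := fun i => by
    rw [← h2, pderiv_C]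
  have c1 := pderiv_comm 1 2 g
  have c2 := pderiv_comm 0 2 g
  have c3 := pderiv_comm 0 1 g
  let b₁ : Derivation F (MvPolynomial (Fin 3) F) (MvPolynomial (Fin 3) F) :=
    pderiv 1 + (2 * x) • pderiv 0
  have hb : ∀ f, b₁ f = pderiv 1 f + 2 * (C x * pderiv 0 f) := by
    intro f
    simp [b₁, MvPolynomial.smul_eq_C_mul, mul_assoc, h2]
  refine ⟨pderiv 0 g ^ 2 * (2 * dirDeriv x (pderiv 0 g) + b₁ (b₁ g)) -
    2 * (b₁ g * pderiv 0 g * b₁ (pderiv 0 g)) + b₁ g ^ 2 * pderiv 0 (pderiv 0 g) -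
    dirDeriv x g * pderiv 0 g * pderiv 0 (pderiv 0 g), ?_,
    2 * (pderiv 0 g ^ 2 * b₁ (pderiv 0 g)) - b₁ g * pderiv 0 g * pderiv 0 (pderiv 0 g), ?_⟩
  · simp only [tangencyRem₀, tangencyRem₁, tangencyQuot, dirDeriv_apply, hb, map_add, pderiv_mul,
      pderiv_C, pderiv_pow, zero_mul, zero_add, c1, c2, c3, mul_zero, hp2]
    ring
  · simp only [tangencyRem₁, tangencyQuot, dirDeriv_apply, hb, map_add, pderiv_mul,
      pderiv_C, zero_mul, zero_add, c1, c2, c3, C_mul, h2, hp2]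
    ring

theorem LightLine.derivative_res_pderiv (l : LightLine F) (i : Fin 3)
    (f : MvPolynomial (Fin 3) F) :
    l.res (pderiv i (dirDeriv l.x f)) = Polynomial.derivative (l.res (pderiv i f)) := by
  rw [LightLine.derivative_res]
  congr 1
  simp only [dirDeriv_apply, map_add, pderiv_mul, pderiv_C, pderiv_pow, zero_mul, zero_add,
    mul_zero, pderiv_comm i]

theorem LightLine.Meets.eval_tangencyRem_eq_zero {s t : LightLine F} (h : s.Meets t)
    {g : MvPolynomial (Fin 3) F} (hs : s.res g = 0) (ht : t.res g = 0) :
    (t.res (tangencyRem₀ g)).eval (meetParam s t) = 0 ∧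
      (t.res (tangencyRem₁ g)).eval (meetParam s t) = 0 := by
  set τ := meetParam s t
  let e : MvPolynomial (Fin 3) F →ₐ[F] F := (Polynomial.aeval τ).comp t.res
  have he : ∀ f, (t.res f).eval τ = e f := fun f => by
    simp [e, Polynomial.coe_aeval_eq_eval]
  have hes : ∀ f, (s.res f).eval τ = e f := fun f => by rw [h.eval_res_eq, he]
  have hC : ∀ a : F, e (C a) = a := fun a => by
    rw [← algebraMap_eq, AlgHom.commutes]; simp
  have t1 : e (dirDeriv t.x g) = 0 := by
    rw [← he, ← LightLine.derivative_res, ht]; simp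
  have t2 : e (dirDeriv t.x (dirDeriv t.x g)) = 0 := by
    rw [← he, ← LightLine.derivative_res, ← LightLine.derivative_res, ht]; simp
  have s1 : e (dirDeriv s.x g) = 0 := by
    rw [← hes, ← LightLine.derivative_res, hs]; simp
  have s2 : e (dirDeriv s.x (dirDeriv s.x g)) = 0 := by
    rw [← hes, ← LightLine.derivative_res, ← LightLine.derivative_res, hs]; simp
  have c1 := pderiv_comm 1 2 g
  have c2 := pderiv_comm 0 2 g
  have c3 := pderiv_comm 0 1 g
  simp only [dirDeriv_apply, map_add, map_mul, map_pow, hC, pderiv_mul, pderiv_C, pderiv_pow,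
    zero_mul, zero_add, mul_zero, c1, c2, c3] at t1 t2 s1 s2
  rw [he, he]
  have hne := h.sub_ne_zero
  have hrem : ∀ x : F, e (tangencyRem₀ g) + x * e (tangencyRem₁ g) =
      e (pderiv 0 g) ^ 3 * e (dirDeriv x (dirDeriv x g)) - e (dirDeriv x g) *
      (e (tangencyQuot g) + x * (2 * (e (pderiv 0 g) ^ 2 * e (pderiv 0 (pderiv 1 g))) -
        e (pderiv 0 (pderiv 0 g)) * e (pderiv 1 g) * e (pderiv 0 g)) +
        x ^ 2 * (e (pderiv 0 g) ^ 2 * e (pderiv 0 (pderiv 0 g)))) := by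
    intro x
    simp only [tangencyRem₀, tangencyRem₁, tangencyQuot, dirDeriv_apply, map_add, map_sub,
      map_mul, map_pow, hC, pderiv_mul, pderiv_C, pderiv_pow, zero_mul, zero_add, mul_zero,
      c1, c2, c3, map_ofNat]
    ring
  have r1 := hrem t.x
  have r2 := hrem s.x
  simp only [dirDeriv_apply, map_add, map_mul, map_pow, hC, pderiv_mul, pderiv_C, pderiv_pow,
    zero_mul, zero_add, mul_zero, c1, c2, c3, t1, t2, s1, s2, sub_zero] at r1 r2
  have hr : e (tangencyRem₁ g) = 0 := by
    have : (s.x - t.x) * e (tangencyRem₁ g) = 0 := by linear_combination r2 - r1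
    exact (mul_eq_zero.1 this).resolve_left hne
  exact ⟨by linear_combination r1 - t.x * hr, hr⟩

/-- Along a line of a doubly ruled surface, the second ruling is given by an affine condition. -/
theorem LightLine.exists_ruling (p : ℕ) [CharP F p] {g : MvPolynomial (Fin 3) F} (t : LightLine F)
    (hg1 : 1 ≤ g.totalDegree) (hgp : 2 * g.totalDegree < p)
    (h0 : g ∣ tangencyRem₀ g) (h1 : g ∣ tangencyRem₁ g) (ht : t.res g = 0)
    (hv : t.res (pderiv 0 g) ≠ 0) :
    ∃ α β : F, ∀ s : LightLine F, s.Meets t → s.res g = 0 →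
      (t.res (pderiv 0 g)).eval (meetParam s t) ≠ 0 →
        α * (s.x - t.x) + β * (s.y - t.y) = 1 := by
  set a := t.res (pderiv 0 g) with ha
  set c := t.res (pderiv 1 g + C (2 * t.x) * pderiv 0 g) with hc
  -- the second root of the first tangency polynomial
  have hmeet : ∀ s : LightLine F, s.Meets t → s.res g = 0 →
      a.eval (meetParam s t) * (s.x - t.x) = - c.eval (meetParam s t) := by
    intro s hst hs
    set τ := meetParam s t
    have t1 : (t.res (dirDeriv t.x g)).eval τ = 0 := by
      rw [← LightLine.derivative_res, ht]; simp
    have s1 : (t.res (dirDeriv s.x g)).eval τ = 0 := by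
      rw [← hst.eval_res_eq, ← LightLine.derivative_res, hs]; simp
    have hC : ∀ a : F, t.res (C a) = Polynomial.C a := fun a => by
      rw [← algebraMap_eq, AlgHom.commutes]; simp
    simp only [dirDeriv_apply, map_add, map_mul, map_pow, hC, Polynomial.eval_add,
      Polynomial.eval_mul, Polynomial.eval_pow, Polynomial.eval_C] at t1 s1
    rw [ha, hc]
    simp only [map_add, map_mul, hC, Polynomial.eval_add, Polynomial.eval_mul, Polynomial.eval_C]
    apply mul_left_cancel₀ hst.sub_ne_zero
    linear_combination s1 - t1
  by_cases hc0 : c = 0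
  · refine ⟨0, 0, fun s hst hs hne => ?_⟩
    have := hmeet s hst hs
    rw [hc0, Polynomial.eval_zero, neg_zero] at this
    rcases mul_eq_zero.1 this with h | h
    · exact absurd h hne
    · exact absurd h hst.sub_ne_zero
  have hode : c * (c * Polynomial.derivative (Polynomial.derivative a) -
      a * Polynomial.derivative (Polynomial.derivative c)) =
      2 * Polynomial.derivative c * (c * Polynomial.derivative a -
        a * Polynomial.derivative c) := by
    obtain ⟨B, hR0, B', hR1⟩ := tangencyRem_eq g t.x
    have hR : g ∣ tangencyRem₀ g + C t.x * tangencyRem₁ g := dvd_add h0 (h1.mul_left _)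
    have hD : t.res (dirDeriv t.x g) = 0 := by
      rw [← LightLine.derivative_res, ht]; simp
    have hDD : t.res (dirDeriv t.x (dirDeriv t.x g)) = 0 := by
      rw [← LightLine.derivative_res, hD]; simp
    have e1 : 0 = 2 * (a ^ 3 * Polynomial.derivative c) - c * t.res B := by
      rw [hc]
      obtain ⟨q, hq⟩ := h1
      generalize pderiv 1 g + C (2 * t.x) * pderiv 0 g = G at hR1 ⊢
      have e := congrArg t.res hR1
      simpa only [hq, map_mul, map_sub, ht, hD, zero_mul, sub_zero, map_pow, map_ofNat,
        ← LightLine.derivative_res] using e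
    obtain ⟨h, hh⟩ := hR
    have hC : ∀ a : F, t.res (C a) = Polynomial.C a := fun a => by
      rw [← algebraMap_eq, AlgHom.commutes]; simp
    have hE : ∀ i, t.res (pderiv i g) * t.res h =
        a ^ 3 * Polynomial.derivative (Polynomial.derivative (t.res (pderiv i g))) -
          Polynomial.derivative (t.res (pderiv i g)) * t.res B := by
      intro i
      have e2 := congrArg (fun f => t.res (pderiv i f)) (hh.symm.trans hR0)
      simp only [pderiv_mul, map_sub, map_add, map_mul, ht, hD, hDD, zero_mul, mul_zero,
        add_zero, zero_add, map_pow, LightLine.derivative_res_pderiv] at e2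
      rw [← ha] at e2
      exact e2
    have hE0 := hE 0
    have hE1 := hE 1
    rw [← ha] at hE0
    have hc' : c = t.res (pderiv 1 g) + Polynomial.C (2 * t.x) * a := by
      rw [hc, map_add, map_mul, hC]
    have hEc : c * t.res h = a ^ 3 * Polynomial.derivative (Polynomial.derivative c) -
        Polynomial.derivative c * t.res B := by
      rw [hc']
      simp only [map_add, Polynomial.derivative_C_mul]
      linear_combination hE1 + Polynomial.C (2 * t.x) * hE0
    apply mul_left_cancel₀ (pow_ne_zero 3 hv)
    linear_combination (-c ^ 2) * hE0 + a * c * hEc +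
      (c * Polynomial.derivative a - a * Polynomial.derivative c) * e1
  have hdeg : ∀ i, (t.res (pderiv i g)).natDegree ≤ g.totalDegree := fun i =>
    (t.natDegree_res_le _).trans (totalDegree_pderiv_le i g)
  obtain ⟨α, β, hαβ⟩ := exists_eq_linear_mul p hgp hg1 (hdeg 0) (by
    refine (t.natDegree_res_le _).trans (totalDegree_add_le_of_le (totalDegree_pderiv_le _ _) ?_)
    refine (totalDegree_mul _ _).trans ?_
    rw [totalDegree_C, zero_add]
    exact totalDegree_pderiv_le _ _) hc0 hode
  refine ⟨-α, β, fun s hst hs hne => ?_⟩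
  have hm := hmeet s hst hs
  have hsub := hst.sub_ne_zero
  have hτ : (s.x - t.x) * meetParam s t = t.y - s.y := by
    rw [meetParam]; field_simp
  have e3 := congrArg (Polynomial.eval (meetParam s t)) hαβ
  simp only [Polynomial.eval_mul, Polynomial.eval_add, Polynomial.eval_C,
    Polynomial.eval_X] at e3
  rw [← ha] at e3
  have hcne : c.eval (meetParam s t) ≠ 0 := by
    intro h
    rw [h, mul_zero] at e3
    exact hne e3
  apply mul_left_cancel₀ hcne
  rw [e3] at hm
  linear_combination -hm + β * c.eval (meetParam s t) * hτ

end

section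

variable {F : Type*} [Field F]
open MvPolynomial LightLine

open Classical in
/-- The lines of `S` inside the zero set of `f` which meet `t`. -/
noncomputable def nbrs (S : Finset (LightLine F)) (f : MvPolynomial (Fin 3) F) (t : LightLine F) :
    Finset (LightLine F) :=
  S.filter fun s => s.Meets t ∧ s.res f = 0

theorem mem_nbrs {S : Finset (LightLine F)} {f : MvPolynomial (Fin 3) F} {s t : LightLine F} :
    s ∈ nbrs S f t ↔ s ∈ S ∧ s.Meets t ∧ s.res f = 0 := by
  simp [nbrs]

theorem nbrs_subset (S : Finset (LightLine F)) (f : MvPolynomial (Fin 3) F) (t : LightLine F) :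
    nbrs S f t ⊆ S := fun _ h => (mem_nbrs.1 h).1

open Classical in
/-- At most `k` lines of `S` meeting a line of `T` satisfy a given affine condition. -/
def PencilBound (S T : Finset (LightLine F)) (k : ℕ) : Prop :=
  ∀ t ∈ T, ∀ α β : F,
    (S.filter fun s => s.Meets t ∧ α * (s.x - t.x) + β * (s.y - t.y) = 1).card ≤ k

open Classical in
/-- The lines of `T` meeting more than `r` lines of `S` inside the zero set of `f`. -/
noncomputable def richLines (S T : Finset (LightLine F)) (f : MvPolynomial (Fin 3) F) (r : ℕ) :
    Finset (LightLine F) :=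
  T.filter fun t => r < (nbrs S f t).card

theorem mem_richLines {S T : Finset (LightLine F)} {f : MvPolynomial (Fin 3) F} {r : ℕ}
    {t : LightLine F} : t ∈ richLines S T f r ↔ t ∈ T ∧ r < (nbrs S f t).card := by
  simp [richLines]

theorem richLines_subset (S T : Finset (LightLine F)) (f : MvPolynomial (Fin 3) F) (r : ℕ) :
    richLines S T f r ⊆ T := fun _ h => (mem_richLines.1 h).1

theorem res_eq_zero_of_lt_card_nbrs {S : Finset (LightLine F)} (hS : Skew S)
    {f : MvPolynomial (Fin 3) F} {t : LightLine F} (h : f.totalDegree < (nbrs S f t).card) :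
    t.res f = 0 := by
  refine eq_zero_of_meets hS (nbrs_subset S f t) t (fun s hs => (mem_nbrs.1 hs).2.1) _
    (fun s hs => ?_) (lt_of_le_of_lt (t.natDegree_res_le f) h)
  rw [← (mem_nbrs.1 hs).2.1.eval_res_eq, (mem_nbrs.1 hs).2.2, Polynomial.eval_zero]

theorem one_le_totalDegree_of_irreducible {g : MvPolynomial (Fin 3) F} (hg : Irreducible g) :
    1 ≤ g.totalDegree := by
  by_contra h
  have h0 : g.totalDegree = 0 := by omega
  rw [totalDegree_eq_zero_iff_eq_C] at h0
  have hc : g.coeff 0 ≠ 0 := by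
    intro h1
    rw [h1, C_0] at h0
    exact hg.ne_zero h0
  apply hg.not_isUnit
  rw [h0]
  exact (IsUnit.mk0 _ hc).map C

theorem card_le_of_pderiv_zero_eq_zero (p : ℕ) [CharP F p] {g : MvPolynomial (Fin 3) F}
    (hg : g ≠ 0) (hgp : g.totalDegree < p) (h : pderiv 0 g = 0) (L : Finset (LightLine F))
    (hx : Set.InjOn LightLine.x (L : Set (LightLine F))) (hL : ∀ l ∈ L, l.res g = 0) :
    L.card ≤ g.totalDegree := by
  have h1 : (finSuccEquiv F 2 g).natDegree = 0 := by
    refine natDegree_eq_zero_of_derivative p _ ?_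
      (lt_of_le_of_lt (natDegree_finSuccEquiv_le g) hgp)
    rw [← finSuccEquiv_pderiv_zero, h, map_zero]
  obtain ⟨c, hc⟩ := Polynomial.natDegree_eq_zero.1 h1
  have hc0 : c ≠ 0 := by
    rintro rfl
    rw [Polynomial.C_0] at hc
    exact hg ((map_eq_zero_iff _ (finSuccEquiv F 2).injective).1 hc.symm)
  refine (card_planeRes_eq_zero_le hc0 L LightLine.x LightLine.y hx (fun l hl => ?_)).trans ?_
  · rw [← res_comp_finSuccEquiv_symm_C, hc, AlgEquiv.symm_apply_apply, hL l hl]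
  · have := totalDegree_coeff_finSuccEquiv_le g 0
    rwa [← hc, Polynomial.coeff_C_zero] at this

theorem isRelPrime_pderiv_zero {g : MvPolynomial (Fin 3) F} (hg : Irreducible g)
    (h : pderiv 0 g ≠ 0) : IsRelPrime g (pderiv 0 g) := by
  rw [hg.isRelPrime_iff_not_dvd]
  intro hdvd
  have h1 := map_dvd (finSuccEquiv F 2) hdvd
  rw [finSuccEquiv_pderiv_zero] at h1
  have h2 : Polynomial.derivative (finSuccEquiv F 2 g) ≠ 0 := by
    rw [← finSuccEquiv_pderiv_zero]
    simpa using h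
  have h3 := Polynomial.natDegree_le_of_dvd h1 h2
  have h4 : (finSuccEquiv F 2 g).natDegree ≠ 0 := by
    intro h5
    obtain ⟨c, hc⟩ := Polynomial.natDegree_eq_zero.1 h5
    rw [← hc] at h2
    simp at h2
  have h5 := Polynomial.natDegree_derivative_lt h4
  omega

theorem card_richLines_irreducible_le (p : ℕ) [CharP F p] {S T : Finset (LightLine F)} {k : ℕ}
    (hS : Skew S) (hSx : Set.InjOn LightLine.x (S : Set (LightLine F)))
    (hTx : Set.InjOn LightLine.x (T : Set (LightLine F))) (hk : PencilBound S T k)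
    {g : MvPolynomial (Fin 3) F} (hg : Irreducible g) (hgp : 2 * g.totalDegree < p) :
    (richLines S T g (k + 10 * g.totalDegree)).card ≤ 10 * g.totalDegree ^ 2 := by
  classical
  set d := g.totalDegree with hd
  have hd1 : 1 ≤ d := one_le_totalDegree_of_irreducible hg
  set R := richLines S T g (k + 10 * d) with hR
  have hRc : ∀ t ∈ R, k + 10 * d < (nbrs S g t).card := fun t ht => (mem_richLines.1 ht).2
  have hRx : ∀ U ⊆ R, Set.InjOn LightLine.x (U : Set (LightLine F)) := fun U hU =>
    hTx.mono (Finset.coe_subset.2 (hU.trans (richLines_subset _ _ _ _)))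
  have hRg : ∀ t ∈ R, t.res g = 0 := fun t ht =>
    res_eq_zero_of_lt_card_nbrs hS (by have := hRc t ht; omega)
  by_cases hv : pderiv 0 g = 0
  · rcases R.eq_empty_or_nonempty with h | ⟨t, ht⟩
    · simp [h]
    · have h1 := card_le_of_pderiv_zero_eq_zero p hg.ne_zero (by omega) hv (nbrs S g t)
        (hSx.mono (Finset.coe_subset.2 (nbrs_subset _ _ _))) (fun l hl => (mem_nbrs.1 hl).2.2)
      have h2 := hRc t ht
      omega
  have hrem : ∀ r : MvPolynomial (Fin 3) F, r.totalDegree ≤ 4 * d →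
      (∀ t ∈ R, t.res r = 0) → ¬ g ∣ r → R.card ≤ 10 * d ^ 2 := by
    intro r hr h0 hdvd
    have h1 := card_res_eq_zero_le hg.ne_zero (hg.isRelPrime_iff_not_dvd.2 hdvd) R
      (hRx R subset_rfl) hRg h0
    rw [← hd] at h1
    nlinarith [Nat.mul_le_mul_left d hr]
  have hkill : ∀ r : MvPolynomial (Fin 3) F, r.totalDegree ≤ 4 * d →
      (∀ s t : LightLine F, s.Meets t → s.res g = 0 → t.res g = 0 →
        (t.res r).eval (meetParam s t) = 0) → ∀ t ∈ R, t.res r = 0 := by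
    intro r hr h0 t ht
    refine eq_zero_of_meets hS (nbrs_subset S g t) t (fun s hs => (mem_nbrs.1 hs).2.1) _
      (fun s hs => h0 s t (mem_nbrs.1 hs).2.1 (mem_nbrs.1 hs).2.2 (hRg t ht)) ?_
    have := t.natDegree_res_le r
    have := hRc t ht
    omega
  by_cases h0 : g ∣ tangencyRem₀ g
  swap
  · exact hrem _ (totalDegree_tangencyRem₀_le g) (hkill _ (totalDegree_tangencyRem₀_le g)
      fun s t hst hs ht => (hst.eval_tangencyRem_eq_zero hs ht).1) h0
  by_cases h1 : g ∣ tangencyRem₁ g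
  swap
  · exact hrem _ (totalDegree_tangencyRem₁_le g) (hkill _ (totalDegree_tangencyRem₁_le g)
      fun s t hst hs ht => (hst.eval_tangencyRem_eq_zero hs ht).2) h1
  have hsing : ∀ t ∈ R, t.res (pderiv 0 g) = 0 := by
    intro t ht
    by_contra hne
    obtain ⟨α, β, hαβ⟩ := exists_ruling p t hd1 hgp h0 h1 (hRg t ht) hne
    have hsplit := Finset.card_filter_add_card_filter_not (s := nbrs S g t)
      (fun s => (t.res (pderiv 0 g)).eval (meetParam s t) = 0)
    have hA : ((nbrs S g t).filter
        fun s => (t.res (pderiv 0 g)).eval (meetParam s t) = 0).card ≤ d := by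
      by_contra hlt
      apply hne
      refine eq_zero_of_meets hS ((Finset.filter_subset _ _).trans (nbrs_subset S g t)) t
        (fun s hs => (mem_nbrs.1 (Finset.mem_filter.1 hs).1).2.1) _
        (fun s hs => (Finset.mem_filter.1 hs).2) ?_
      have := (t.natDegree_res_le (pderiv 0 g)).trans (totalDegree_pderiv_le 0 g)
      omega
    have hB : ((nbrs S g t).filter
        fun s => ¬ (t.res (pderiv 0 g)).eval (meetParam s t) = 0).card ≤ k := by
      refine (Finset.card_le_card fun s hs => ?_).trans
        (hk t (richLines_subset _ _ _ _ ht) α β)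
      obtain ⟨h1, h2⟩ := Finset.mem_filter.1 hs
      obtain ⟨h3, h4, h5⟩ := mem_nbrs.1 h1
      exact Finset.mem_filter.2 ⟨h3, h4, hαβ s h4 h5 h2⟩
    have := hRc t ht
    omega
  have h2 := card_res_eq_zero_le hg.ne_zero (isRelPrime_pderiv_zero hg hv) R
      (hRx R subset_rfl) hRg hsing
  rw [← hd] at h2
  nlinarith [Nat.mul_le_mul_left d (totalDegree_pderiv_le (0 : Fin 3) g)]

theorem richLines_mono {S T : Finset (LightLine F)} {f g : MvPolynomial (Fin 3) F} {r r' : ℕ}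
    (h : ∀ l : LightLine F, l.res f = 0 → l.res g = 0) (hr : r' ≤ r) :
    richLines S T f r ⊆ richLines S T g r' := by
  intro t ht
  obtain ⟨h1, h2⟩ := mem_richLines.1 ht
  refine mem_richLines.2 ⟨h1, lt_of_le_of_lt hr (lt_of_lt_of_le h2 (Finset.card_le_card ?_))⟩
  intro s hs
  obtain ⟨h3, h4, h5⟩ := mem_nbrs.1 hs
  exact mem_nbrs.2 ⟨h3, h4, h s h5⟩

/-- Few lines of `T` meet many lines of `S` inside a surface. -/
theorem card_richLines_le (p : ℕ) [CharP F p] {S T : Finset (LightLine F)} {k : ℕ}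
    (hS : Skew S) (hSx : Set.InjOn LightLine.x (S : Set (LightLine F)))
    (hTx : Set.InjOn LightLine.x (T : Set (LightLine F))) (hk : PencilBound S T k)
    (f : MvPolynomial (Fin 3) F) (hf : f ≠ 0) (hfp : 2 * f.totalDegree < p) :
    (richLines S T f (k + 10 * f.totalDegree)).card ≤ 10 * f.totalDegree ^ 2 := by
  classical
  have hunit : ∀ u : MvPolynomial (Fin 3) F, IsUnit u → ∀ r, richLines S T u r = ∅ := by
    intro u hu r
    refine Finset.eq_empty_of_forall_notMem fun t ht => ?_
    have h1 := (mem_richLines.1 ht).2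
    obtain ⟨s, hs⟩ := Finset.card_pos.1 (lt_of_le_of_lt (Nat.zero_le r) h1)
    have h2 := (mem_nbrs.1 hs).2.2
    exact (hu.map s.res).ne_zero h2
  induction f using UniqueFactorizationMonoid.induction_on_coprime with
  | h0 => exact absurd rfl hf
  | h1 hu => simp [hunit _ hu]
  | @hpr g i hg =>
    rcases Nat.eq_zero_or_pos i with rfl | hi
    · rw [hunit _ (by simp)]
      simp
    · have hdeg : g.totalDegree ≤ (g ^ i).totalDegree := by
        obtain ⟨j, rfl⟩ : ∃ j, i = j + 1 := ⟨i - 1, by omega⟩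
        rw [pow_succ, totalDegree_mul_of_isDomain (pow_ne_zero _ hg.ne_zero) hg.ne_zero]
        omega
      refine (Finset.card_le_card (richLines_mono (g := g) (r' := k + 10 * g.totalDegree)
        (fun l hl => ?_) (by omega))).trans ((card_richLines_irreducible_le p hS hSx hTx hk
        hg.irreducible (by omega)).trans (by gcongr))
      rw [map_pow] at hl
      exact eq_zero_of_pow_eq_zero hl
  | @hcp g h hrel ihg ihh =>
    have hg0 : g ≠ 0 := left_ne_zero_of_mul hf
    have hh0 : h ≠ 0 := right_ne_zero_of_mul hf
    have hdeg := totalDegree_mul_of_isDomain hg0 hh0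
    rw [hdeg] at hfp ⊢
    have ihg := ihg hg0 (by omega)
    have ihh := ihh hh0 (by omega)
    set R := richLines S T (g * h) (k + 10 * (g.totalDegree + h.totalDegree)) with hR
    have hsub : R ⊆ (richLines S T g (k + 10 * g.totalDegree) ∪
        richLines S T h (k + 10 * h.totalDegree)) ∪
        R.filter (fun t => t.res g = 0 ∧ t.res h = 0) := by
      intro t ht
      obtain ⟨htT, htc⟩ := mem_richLines.1 ht
      have hun : (nbrs S (g * h) t).card ≤ (nbrs S g t).card + (nbrs S h t).card := by
        refine (Finset.card_le_card fun s hs => ?_).trans (Finset.card_union_le _ _)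
        obtain ⟨h3, h4, h5⟩ := mem_nbrs.1 hs
        rw [map_mul, mul_eq_zero] at h5
        rcases h5 with h5 | h5
        · exact Finset.mem_union_left _ (mem_nbrs.2 ⟨h3, h4, h5⟩)
        · exact Finset.mem_union_right _ (mem_nbrs.2 ⟨h3, h4, h5⟩)
      by_cases h1 : t.res g = 0
      · by_cases h2 : t.res h = 0
        · exact Finset.mem_union_right _ (Finset.mem_filter.2 ⟨ht, h1, h2⟩)
        · have h3 : (nbrs S h t).card ≤ h.totalDegree := by
            by_contra hlt
            exact h2 (res_eq_zero_of_lt_card_nbrs hS (by omega))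
          refine Finset.mem_union_left _ (Finset.mem_union_left _
            (mem_richLines.2 ⟨htT, by omega⟩))
      · have h3 : (nbrs S g t).card ≤ g.totalDegree := by
          by_contra hlt
          exact h1 (res_eq_zero_of_lt_card_nbrs hS (by omega))
        refine Finset.mem_union_left _ (Finset.mem_union_right _
          (mem_richLines.2 ⟨htT, by omega⟩))
    have hboth : (R.filter (fun t => t.res g = 0 ∧ t.res h = 0)).card ≤
        2 * (g.totalDegree * h.totalDegree) := by
      refine card_res_eq_zero_le hg0 hrel _ (hTx.mono (Finset.coe_subset.2
        ((Finset.filter_subset _ _).trans (richLines_subset _ _ _ _)))) ?_ ?_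
      · exact fun l hl => (Finset.mem_filter.1 hl).2.1
      · exact fun l hl => (Finset.mem_filter.1 hl).2.2
    have h1 := Finset.card_le_card hsub
    have h2 := Finset.card_union_le (richLines S T g (k + 10 * g.totalDegree) ∪
        richLines S T h (k + 10 * h.totalDegree))
        (R.filter (fun t => t.res g = 0 ∧ t.res h = 0))
    have h3 := Finset.card_union_le (richLines S T g (k + 10 * g.totalDegree))
        (richLines S T h (k + 10 * h.totalDegree))
    nlinarith

end

section

variable {F : Type*} [Field F]
open MvPolynomial LightLine

/-- The polynomial with prescribed coefficients on a box of exponents. -/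
noncomputable def boxPoly (e : ℕ) : ((Fin 3 → Fin e) → F) →ₗ[F] MvPolynomial (Fin 3) F :=
  ∑ i, (monomial (Finsupp.equivFunOnFinite.symm fun j => (i j : ℕ))).comp (LinearMap.proj i)

theorem boxPoly_apply (e : ℕ) (v : (Fin 3 → Fin e) → F) :
    boxPoly e v = ∑ i, monomial (Finsupp.equivFunOnFinite.symm fun j => (i j : ℕ)) (v i) := by
  simp [boxPoly]

theorem boxPoly_injective (e : ℕ) : Function.Injective (boxPoly (F := F) e) := by
  classical
  rw [← LinearMap.ker_eq_bot, LinearMap.ker_eq_bot']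
  intro v hv
  funext i
  have h := congrArg (coeff (Finsupp.equivFunOnFinite.symm fun j => (i j : ℕ))) hv
  rw [boxPoly_apply, coeff_sum, Finset.sum_eq_single i] at h
  · simpa using h
  · intro b _ hb
    rw [coeff_monomial, if_neg]
    intro h'
    apply hb
    funext j
    have := congrFun (Finsupp.equivFunOnFinite.symm.injective h') j
    exact Fin.ext this
  · simp

theorem totalDegree_boxPoly_le (e : ℕ) (v : (Fin 3 → Fin e) → F) :
    (boxPoly e v).totalDegree ≤ 3 * (e - 1) := by
  rw [boxPoly_apply]
  refine totalDegree_finsetSum_le fun i _ => ?_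
  refine (totalDegree_monomial_le _ _).trans ?_
  rw [Finsupp.sum_fintype _ _ (by simp), Fin.sum_univ_three]
  have h0 := (i 0).isLt
  have h1 := (i 1).isLt
  have h2 := (i 2).isLt
  simp only [Finsupp.equivFunOnFinite_symm_apply_apply, id_eq]
  omega

/-- Few light lines lie on a surface of small degree. -/
theorem exists_res_eq_zero (L : Finset (LightLine F)) (e : ℕ) (h : 3 * L.card < e ^ 2) :
    ∃ f : MvPolynomial (Fin 3) F, f ≠ 0 ∧ f.totalDegree ≤ 3 * (e - 1) ∧
      ∀ l ∈ L, l.res f = 0 := by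
  have he : 0 < e := by
    rcases Nat.eq_zero_or_pos e with rfl | h'
    · simp at h
    · exact h'
  let Φ : ((Fin 3 → Fin e) → F) →ₗ[F] (L × Fin (3 * e) → F) :=
    LinearMap.pi fun q => (Polynomial.lcoeff F q.2).comp
      ((q.1 : LightLine F).res.toLinearMap.comp (boxPoly e))
  have hker : LinearMap.ker Φ ≠ ⊥ := by
    apply LinearMap.ker_ne_bot_of_finrank_lt
    simp only [Module.finrank_fintype_fun_eq_card, Fintype.card_prod, Fintype.card_coe,
      Fintype.card_fin, Fintype.card_fun]
    calc L.card * (3 * e) = (3 * L.card) * e := by ring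
      _ < e ^ 2 * e := Nat.mul_lt_mul_of_pos_right h he
      _ = e ^ 3 := by ring
  obtain ⟨v, hv, hv0⟩ := (Submodule.ne_bot_iff _).1 hker
  have hdeg := totalDegree_boxPoly_le e v
  refine ⟨boxPoly e v, fun h0 => hv0 (boxPoly_injective e (by rw [h0, map_zero])), hdeg,
    fun l hl => ?_⟩
  ext n
  rw [Polynomial.coeff_zero]
  by_cases hn : n < 3 * e
  · have := congrFun (LinearMap.mem_ker.1 hv) (⟨l, hl⟩, ⟨n, hn⟩)
    simpa [Φ] using this
  · apply Polynomial.coeff_eq_zero_of_natDegree_lt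
    have := l.natDegree_res_le (boxPoly e v)
    omega

open Classical in
/-- The number of pairs of lines of `S` and `T` which meet. -/
noncomputable def meetCount (S T : Finset (LightLine F)) : ℕ :=
  ∑ t ∈ T, (S.filter fun s => s.Meets t).card

theorem meetCount_union_le [DecidableEq (LightLine F)] (S S' T : Finset (LightLine F)) :
    meetCount (S ∪ S') T ≤ meetCount S T + meetCount S' T := by
  classical
  rw [meetCount, meetCount, meetCount, ← Finset.sum_add_distrib]
  refine Finset.sum_le_sum fun t _ => ?_
  rw [Finset.filter_union]
  exact Finset.card_union_le _ _

theorem PencilBound.mono {S T S' T' : Finset (LightLine F)} {k : ℕ} (h : PencilBound S T k)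
    (hS : S' ⊆ S) (hT : T' ⊆ T) : PencilBound S' T' k := by
  classical
  exact fun t ht α β => (Finset.card_le_card (Finset.filter_subset_filter _ hS)).trans
      (h t (hT ht) α β)

/-- The incidence bound for two families of light lines, by repeated halving. -/
theorem meetCount_le_of_card_le_two_pow (p : ℕ) [CharP F p] (k j : ℕ) {S T : Finset (LightLine F)}
    (hS : Skew S) (hSx : Set.InjOn LightLine.x (S : Set (LightLine F)))
    (hTx : Set.InjOn LightLine.x (T : Set (LightLine F))) (hk : PencilBound S T k)
    (hj : S.card ≤ 2 ^ j) (hp : 6 * Nat.sqrt (3 * 2 ^ j) < p) :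
    meetCount S T ≤ (T.card + 540 * j * 2 ^ j) * (k + 30 * Nat.sqrt (3 * 2 ^ j)) := by
  classical
  induction j generalizing S T with
  | zero =>
    have h1 : 1 ≤ Nat.sqrt (3 * 2 ^ 0) := by simp [Nat.le_sqrt]
    calc meetCount S T ≤ ∑ t ∈ T, 1 :=
          Finset.sum_le_sum fun t _ => (Finset.card_filter_le _ _).trans hj
      _ = T.card := by simp
      _ ≤ _ := by
        rw [mul_zero, zero_mul, add_zero]
        exact Nat.le_mul_of_pos_right _ (by omega)
  | succ j ih =>
    set r := Nat.sqrt (3 * 2 ^ (j + 1)) with hr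
    have hrr : r * r ≤ 3 * 2 ^ (j + 1) := Nat.sqrt_le _
    have hmono : Nat.sqrt (3 * 2 ^ j) ≤ r :=
      Nat.sqrt_le_sqrt (Nat.mul_le_mul_left _ (Nat.pow_le_pow_right (by norm_num) (by omega)))
    obtain ⟨f, hf0, hfd, hf⟩ := exists_res_eq_zero S (r + 1) (by
      have := Nat.lt_succ_sqrt (3 * 2 ^ (j + 1))
      rw [← hr] at this
      calc 3 * S.card ≤ 3 * 2 ^ (j + 1) := Nat.mul_le_mul_left _ hj
        _ < (r + 1) * (r + 1) := this
        _ = _ := by ring)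
    rw [Nat.add_sub_cancel] at hfd
    have hrich := card_richLines_le p hS hSx hTx hk f hf0 (by omega)
    set T' := richLines S T f (k + 10 * f.totalDegree) with hT'
    have hT'T : T' ⊆ T := richLines_subset _ _ _ _
    have hT'c : T'.card ≤ 270 * 2 ^ (j + 1) := by
      nlinarith [Nat.mul_le_mul hfd hfd]
    have hpoor : ∀ t ∈ T \ T', (S.filter fun s => s.Meets t).card ≤ k + 30 * r := by
      intro t ht
      obtain ⟨h1, h2⟩ := Finset.mem_sdiff.1 ht
      rw [hT', mem_richLines] at h2
      have h3 : ¬ (k + 10 * f.totalDegree < (nbrs S f t).card) := fun h => h2 ⟨h1, h⟩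
      have h4 : (S.filter fun s => s.Meets t) ⊆ nbrs S f t := fun s hs => by
        obtain ⟨h5, h6⟩ := Finset.mem_filter.1 hs
        exact mem_nbrs.2 ⟨h5, h6, hf s h5⟩
      have := Finset.card_le_card h4
      omega
    have hsplit : meetCount S T ≤ T.card * (k + 30 * r) + meetCount S T' := by
      rw [meetCount, ← Finset.sum_sdiff hT'T]
      refine Nat.add_le_add ((Finset.sum_le_card_nsmul _ _ _ hpoor).trans ?_) le_rfl
      rw [smul_eq_mul]
      exact Nat.mul_le_mul_right _ (Finset.card_le_card Finset.sdiff_subset)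
    obtain ⟨S₁, hS₁, hc₁⟩ := Finset.exists_subset_card_eq (s := S) (n := min S.card (2 ^ j))
      (min_le_left _ _)
    have hc₂ : (S \ S₁).card ≤ 2 ^ j := by
      rw [Finset.card_sdiff_of_subset hS₁]
      rw [pow_succ] at hj
      omega
    have hhalf : ∀ U ⊆ S, U.card ≤ 2 ^ j →
        meetCount U T' ≤ (T'.card + 540 * j * 2 ^ j) * (k + 30 * r) := by
      intro U hU hUc
      refine (ih (fun s hs t ht => hS s (hU hs) t (hU ht))
        (hSx.mono (Finset.coe_subset.2 hU)) (hTx.mono (Finset.coe_subset.2 hT'T))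
        (hk.mono hU hT'T) hUc (by omega)).trans ?_
      exact Nat.mul_le_mul_left _ (by omega)
    have h1 := hhalf S₁ hS₁ (by omega)
    have h2 := hhalf (S \ S₁) Finset.sdiff_subset hc₂
    have h3 := meetCount_union_le S₁ (S \ S₁) T'
    rw [Finset.union_sdiff_of_subset hS₁] at h3
    calc meetCount S T ≤ T.card * (k + 30 * r) + 2 * ((T'.card + 540 * j * 2 ^ j) * (k + 30 * r)) :=
          by omega
      _ = (T.card + (2 * T'.card + 540 * j * 2 ^ (j + 1))) * (k + 30 * r) := by ring
      _ ≤ _ := by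
        refine Nat.mul_le_mul_right _ (Nat.add_le_add_left ?_ _)
        nlinarith

end

section

variable {F : Type*} [Field F]
open MvPolynomial LightLine

namespace LightLine

/-- The light line attached to a point in homogeneous coordinates. -/
def ofPoint (X : Fin 4 → F) : LightLine F where
  x := X 1 / X 0
  y := X 2 / X 0
  w := X 3 / X 0 + X 1 / X 0 * (X 2 / X 0)

/-- The light line attached to a plane in homogeneous coordinates. -/
def ofPlane (Y : Fin 4 → F) : LightLine F where
  x := -Y 2 / Y 3
  y := Y 1 / Y 3
  w := -Y 0 / Y 3 + -Y 2 / Y 3 * (Y 1 / Y 3)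

theorem ofPoint_inter_iff {X Z : Fin 4 → F} (hX : X 0 ≠ 0) (hZ : Z 0 ≠ 0) :
    (ofPoint Z).w - (ofPoint X).w =
      ((ofPoint X).x + (ofPoint Z).x) * ((ofPoint Z).y - (ofPoint X).y) ↔
    X 1 * Z 2 - X 2 * Z 1 - (X 0 * Z 3 - X 3 * Z 0) = 0 := by
  simp only [ofPoint]
  rw [← sub_eq_zero]
  have : Z 3 / Z 0 + Z 1 / Z 0 * (Z 2 / Z 0) - (X 3 / X 0 + X 1 / X 0 * (X 2 / X 0)) -
      (X 1 / X 0 + Z 1 / Z 0) * (Z 2 / Z 0 - X 2 / X 0) =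
      -(X 1 * Z 2 - X 2 * Z 1 - (X 0 * Z 3 - X 3 * Z 0)) / (X 0 * Z 0) := by
    field_simp
    ring
  rw [this, div_eq_zero_iff, neg_eq_zero, or_iff_left (mul_ne_zero hX hZ)]

theorem ofPoint_inter_ofPlane_iff {X Y : Fin 4 → F} (hX : X 0 ≠ 0) (hY : Y 3 ≠ 0) :
    (ofPlane Y).w - (ofPoint X).w =
      ((ofPoint X).x + (ofPlane Y).x) * ((ofPlane Y).y - (ofPoint X).y) ↔
    X 0 * Y 0 + X 1 * Y 1 + X 2 * Y 2 + X 3 * Y 3 = 0 := by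
  simp only [ofPoint, ofPlane]
  rw [← sub_eq_zero]
  have : -Y 0 / Y 3 + -Y 2 / Y 3 * (Y 1 / Y 3) - (X 3 / X 0 + X 1 / X 0 * (X 2 / X 0)) -
      (X 1 / X 0 + -Y 2 / Y 3) * (Y 1 / Y 3 - X 2 / X 0) =
      -(X 0 * Y 0 + X 1 * Y 1 + X 2 * Y 2 + X 3 * Y 3) / (X 0 * Y 3) := by
    field_simp
    ring
  rw [this, div_eq_zero_iff, neg_eq_zero, or_iff_left (mul_ne_zero hX hY)]

end LightLine

section Twist

variable {k : Type*} [Field k] [Algebra k F]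

local notation "ι" => algebraMap k F

/-- A generic projective transformation of a point of three-space. -/
def twistPoint (lam : F) (s : k × k × k) : Fin 4 → F :=
  ![1 + lam ^ 3 * ι s.2.1, ι s.1 + lam * ι s.2.1 + lam ^ 2 * ι s.2.2, ι s.2.1,
    ι s.2.2 + lam ^ 4 * ι s.1 + lam ^ 20 * ι s.2.1]

/-- The dual transformation, applied to the polar plane of a point of three-space. -/
def twistPlane (lam : F) (t : k × k × k) : Fin 4 → F :=
  ![-((1 - lam ^ 6) * ι t.2.2), ι t.2.1 - lam ^ 4,
    lam ^ 3 * (1 - lam ^ 6) * ι t.2.2 + (lam ^ 22 - lam) * ι t.2.1 - (1 - lam ^ 6) * ι t.1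
      + lam ^ 5 - lam ^ 20,
    1 - lam ^ 2 * ι t.2.1]

variable {lam : F}

theorem twistPoint_zero_ne_zero (h : Transcendental k lam) (s : k × k × k) :
    twistPoint lam s 0 ≠ 0 := by
  intro h0
  have h1 := (transcendental_iff.1 h) (1 + Polynomial.C s.2.1 * Polynomial.X ^ 3)
    (by
    simp only [twistPoint, Matrix.cons_val] at h0
    simp only [map_add, map_mul, map_pow, map_one, Polynomial.aeval_C, Polynomial.aeval_X]
    linear_combination h0)
  have := congrArg (fun q => Polynomial.coeff q 0) h1
  simp at this

theorem twistPlane_three_ne_zero (h : Transcendental k lam) (t : k × k × k) :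
    twistPlane lam t 3 ≠ 0 := by
  intro h0
  have h1 := (transcendental_iff.1 h) (1 - Polynomial.C t.2.1 * Polynomial.X ^ 2)
    (by
    simp only [twistPlane, Matrix.cons_val] at h0
    simp only [map_sub, map_mul, map_pow, map_one, Polynomial.aeval_C, Polynomial.aeval_X]
    linear_combination h0)
  have := congrArg (fun q => Polynomial.coeff q 0) h1
  simp at this

theorem one_sub_pow_six_ne_zero (h : Transcendental k lam) : 1 - lam ^ 6 ≠ 0 := by
  intro h0
  have h1 := (transcendental_iff.1 h) (1 - Polynomial.X ^ 6) (by simpa using h0)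
  have := congrArg (fun q => Polynomial.coeff q 0) h1
  simp at this

theorem twistPoint_x_injective (h : Transcendental k lam) :
    Function.Injective fun s : k × k × k => (ofPoint (twistPoint lam s)).x := by
  rintro ⟨a, b, z⟩ ⟨a', b', z'⟩ he
  have h0 := twistPoint_zero_ne_zero h (a, b, z)
  have h0' := twistPoint_zero_ne_zero h (a', b', z')
  simp only [ofPoint] at he
  rw [div_eq_div_iff h0 h0'] at he
  simp only [twistPoint, Matrix.cons_val] at he
  have h1 := (transcendental_iff.1 h) (Polynomial.C (a' - a) +
      Polynomial.C (b' - b) * Polynomial.X + Polynomial.C (z' - z) * Polynomial.X ^ 2 +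
      Polynomial.C (b * a' - b' * a) * Polynomial.X ^ 3 +
      Polynomial.C (b * z' - b' * z) * Polynomial.X ^ 5) (by
    simp only [map_add, map_sub, map_mul, map_pow, Polynomial.aeval_C, Polynomial.aeval_X]
    linear_combination -he)
  have c0 := congrArg (fun q => Polynomial.coeff q 0) h1
  have c1 := congrArg (fun q => Polynomial.coeff q 1) h1
  have c2 := congrArg (fun q => Polynomial.coeff q 2) h1
  simp [Polynomial.coeff_X, Polynomial.coeff_C, Polynomial.coeff_X_pow, -map_sub,
    -map_mul] at c0 c1 c2
  rw [sub_eq_zero] at c0 c1 c2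
  rw [c0, c1, c2]

theorem twistPlane_x_injective (h : Transcendental k lam) :
    Function.Injective fun t : k × k × k => (ofPlane (twistPlane lam t)).x := by
  rintro ⟨a, b, z⟩ ⟨a', b', z'⟩ he
  have h0 := twistPlane_three_ne_zero h (a, b, z)
  have h0' := twistPlane_three_ne_zero h (a', b', z')
  simp only [ofPlane] at he
  rw [div_eq_div_iff h0 h0'] at he
  simp only [twistPlane, Matrix.cons_val] at he
  have h1 := (transcendental_iff.1 h) (Polynomial.C (a - a') +
      Polynomial.C (b - b') * Polynomial.X +
      Polynomial.C (a' * b - a * b') * Polynomial.X ^ 2 +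
      Polynomial.C (z' - z) * Polynomial.X ^ 3 +
      Polynomial.C (z * b' - z' * b) * Polynomial.X ^ 5) (by
    apply (mul_eq_zero.1 (?_ : (1 - lam ^ 6) * _ = 0)).resolve_left (one_sub_pow_six_ne_zero h)
    simp only [map_add, map_sub, map_mul, map_pow, Polynomial.aeval_C, Polynomial.aeval_X]
    linear_combination he)
  have c0 := congrArg (fun q => Polynomial.coeff q 0) h1
  have c1 := congrArg (fun q => Polynomial.coeff q 1) h1
  have c2 := congrArg (fun q => Polynomial.coeff q 3) h1
  simp [Polynomial.coeff_X, Polynomial.coeff_C, Polynomial.coeff_X_pow, -map_sub,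
    -map_mul] at c0 c1 c2
  rw [sub_eq_zero] at c0 c1 c2
  rw [c0, c1, c2]

theorem twistPoint_skew (h : Transcendental k lam) {s s' : k × k × k} (hs : s ≠ s') :
    (ofPoint (twistPoint lam s')).w - (ofPoint (twistPoint lam s)).w ≠
      ((ofPoint (twistPoint lam s)).x + (ofPoint (twistPoint lam s')).x) *
        ((ofPoint (twistPoint lam s')).y - (ofPoint (twistPoint lam s)).y) := by
  rw [Ne, ofPoint_inter_iff (twistPoint_zero_ne_zero h s) (twistPoint_zero_ne_zero h s')]
  intro he
  apply hs
  obtain ⟨a, b, z⟩ := s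
  obtain ⟨a', b', z'⟩ := s'
  simp only [twistPoint, Matrix.cons_val] at he
  have h1 := (transcendental_iff.1 h) (Polynomial.C (z - z' + (a * b' - a' * b)) +
      Polynomial.C (z * b' - z' * b) * (Polynomial.X ^ 2 + Polynomial.X ^ 3) +
      Polynomial.C (a - a') * Polynomial.X ^ 4 +
      Polynomial.C (a * b' - a' * b) * Polynomial.X ^ 7 +
      Polynomial.C (b - b') * Polynomial.X ^ 20) (by
    simp only [map_add, map_sub, map_mul, map_pow, Polynomial.aeval_C, Polynomial.aeval_X]
    linear_combination he)
  have c0 := congrArg (fun q => Polynomial.coeff q 0) h1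
  have c1 := congrArg (fun q => Polynomial.coeff q 4) h1
  have c2 := congrArg (fun q => Polynomial.coeff q 20) h1
  simp [Polynomial.coeff_C, Polynomial.coeff_X_pow, -map_sub, -map_mul, -map_add] at c0 c1 c2
  rw [sub_eq_zero] at c1 c2
  subst c1 c2
  have : z = z' := by linear_combination c0
  rw [this]

theorem twist_x_ne (h : Transcendental k lam) (s t : k × k × k) :
    (ofPoint (twistPoint lam s)).x ≠ (ofPlane (twistPlane lam t)).x := by
  intro he
  simp only [ofPlane, ofPoint] at he
  rw [div_eq_div_iff (twistPoint_zero_ne_zero h s) (twistPlane_three_ne_zero h t)] at he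
  obtain ⟨a, b, z⟩ := s
  obtain ⟨a', b', z'⟩ := t
  simp only [twistPoint, twistPlane, Matrix.cons_val] at he
  have h1 := (transcendental_iff.1 h)
    ((Polynomial.C a + Polynomial.C b * Polynomial.X + Polynomial.C z * Polynomial.X ^ 2) *
        (1 - Polynomial.C b' * Polynomial.X ^ 2) +
      (1 + Polynomial.C b * Polynomial.X ^ 3) *
        (Polynomial.C z' * (Polynomial.X ^ 3 - Polynomial.X ^ 9) +
          Polynomial.C b' * (Polynomial.X ^ 22 - Polynomial.X) -
          Polynomial.C a' * (1 - Polynomial.X ^ 6) + Polynomial.X ^ 5 - Polynomial.X ^ 20)) (by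
    simp only [map_add, map_sub, map_mul, map_pow, Polynomial.aeval_C, Polynomial.aeval_X, map_one]
    linear_combination he)
  have c := congrArg (fun q => Polynomial.coeff q 20) h1
  ring_nf at c
  simp [Polynomial.coeff_X, Polynomial.coeff_C, Polynomial.coeff_X_pow, mul_assoc] at c

theorem twist_meets_iff (h : Transcendental k lam) (s t : k × k × k) :
    (ofPoint (twistPoint lam s)).Meets (ofPlane (twistPlane lam t)) ↔
      s.2.2 - t.2.2 + (s.1 * t.2.1 - t.1 * s.2.1) = 0 := by
  rw [Meets, and_iff_right (twist_x_ne h s t), ofPoint_inter_ofPlane_iff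
    (twistPoint_zero_ne_zero h s) (twistPlane_three_ne_zero h t)]
  have : twistPoint lam s 0 * twistPlane lam t 0 + twistPoint lam s 1 * twistPlane lam t 1 +
      twistPoint lam s 2 * twistPlane lam t 2 + twistPoint lam s 3 * twistPlane lam t 3 =
      (1 - lam ^ 6) * ι (s.2.2 - t.2.2 + (s.1 * t.2.1 - t.1 * s.2.1)) := by
    simp only [twistPoint, twistPlane, Matrix.cons_val, map_add, map_sub, map_mul]
    ring
  rw [this, mul_eq_zero, or_iff_right (one_sub_pow_six_ne_zero h), map_eq_zero]

/-- On a pencil of incident points, either the second coordinate determines the point,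
or the second coordinate is constant. -/
theorem twist_pencil (h : Transcendental k lam) (t : k × k × k) (α β : F) {s s' : k × k × k}
    (hs : s.2.2 - t.2.2 + (s.1 * t.2.1 - t.1 * s.2.1) = 0)
    (hs' : s'.2.2 - t.2.2 + (s'.1 * t.2.1 - t.1 * s'.2.1) = 0)
    (he : α * ((ofPoint (twistPoint lam s)).x - (ofPlane (twistPlane lam t)).x) +
      β * ((ofPoint (twistPoint lam s)).y - (ofPlane (twistPlane lam t)).y) = 1)
    (he' : α * ((ofPoint (twistPoint lam s')).x - (ofPlane (twistPlane lam t)).x) +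
      β * ((ofPoint (twistPoint lam s')).y - (ofPlane (twistPlane lam t)).y) = 1)
    (hc : α = 0 ∧ s.1 = s'.1 ∨ α ≠ 0 ∧ s.2.1 = s'.2.1) : s = s' := by
  have key : ∀ s : k × k × k, s.2.2 - t.2.2 + (s.1 * t.2.1 - t.1 * s.2.1) = 0 →
      α * ((ofPoint (twistPoint lam s)).x - (ofPlane (twistPlane lam t)).x) +
      β * ((ofPoint (twistPoint lam s)).y - (ofPlane (twistPlane lam t)).y) = 1 →
      (-1 - α * (ofPlane (twistPlane lam t)).x - β * (ofPlane (twistPlane lam t)).y) *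
        (1 + lam ^ 3 * ι s.2.1) + α * (ι s.1 * (1 - lam ^ 2 * ι t.2.1) +
          ι s.2.1 * (lam + lam ^ 2 * ι t.1) + lam ^ 2 * ι t.2.2) + β * ι s.2.1 = 0 := by
    intro s hs he
    have h0 := twistPoint_zero_ne_zero h s
    have h1 : (ofPoint (twistPoint lam s)).x * twistPoint lam s 0 = twistPoint lam s 1 := by
      simp only [ofPoint]; field_simp
    have h2 : (ofPoint (twistPoint lam s)).y * twistPoint lam s 0 = twistPoint lam s 2 := by
      simp only [ofPoint]; field_simp
    have hz := congrArg (algebraMap k F) hs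
    simp only [map_add, map_sub, map_mul, map_zero] at hz
    simp only [twistPoint, Matrix.cons_val] at h1 h2
    simp only [twistPoint] at he
    linear_combination (1 + lam ^ 3 * ι s.2.1) * he - α * h1 - β * h2 - α * lam ^ 2 * hz
  have e := key s hs he
  have e' := key s' hs' he'
  have hY := twistPlane_three_ne_zero h t
  simp only [twistPlane, Matrix.cons_val] at hY
  obtain ⟨a, b, z⟩ := s
  obtain ⟨a', b', z'⟩ := s'
  simp only at hs hs' hc e e'
  have hab : a = a' ∧ b = b' := by
    rcases hc with ⟨hα, hc⟩ | ⟨hα, hc⟩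
    · refine ⟨hc, ?_⟩
      subst hc hα
      by_contra hne
      have hne' : ι b - ι b' ≠ 0 := by
        rw [← map_sub, Ne, map_eq_zero]
        exact sub_ne_zero.2 hne
      set l := -1 - β * (ofPlane (twistPlane lam t)).y with hl
      have h3 : l * lam ^ 3 + β = 0 := by
        apply (mul_eq_zero.1 (?_ : (ι b - ι b') * _ = 0)).resolve_left hne'
        linear_combination e - e'
      have h4 : l = 0 := by linear_combination e - ι b * h3
      rw [h4, zero_mul, zero_add] at h3
      rw [h3, zero_mul, sub_zero] at hl
      rw [h4] at hl
      simp at hl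
    · refine ⟨?_, hc⟩
      subst hc
      have h3 : ι a - ι a' = 0 := by
        apply (mul_eq_zero.1 (?_ : (α * (1 - lam ^ 2 * ι t.2.1)) * _ = 0)).resolve_left
          (mul_ne_zero hα hY)
        linear_combination e - e'
      rw [← map_sub, map_eq_zero, sub_eq_zero] at h3
      exact h3
  obtain ⟨rfl, rfl⟩ := hab
  have : z = z' := by linear_combination hs - hs'
  rw [this]

end Twist

end

section

open LightLine

theorem card_incidences_le_of_transcendental (p : ℕ) [Fact p.Prime] {K : Type*} [Field K]
    [Algebra (ZMod p) K] {lam : K} (hlam : Transcendental (ZMod p) lam) (A : Finset (ZMod p))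
    (S T : Finset (ZMod p × ZMod p × ZMod p)) (hS : ∀ s ∈ S, s.1 ∈ A ∧ s.2.1 ∈ A) (j : ℕ)
    (hj : S.card ≤ 2 ^ j) (hp : 6 * Nat.sqrt (3 * 2 ^ j) < p) :
    ((S ×ˢ T).filter fun q =>
      q.1.2.2 - q.2.2.2 + (q.1.1 * q.2.2.1 - q.2.1 * q.1.2.1) = 0).card ≤
    (T.card + 540 * j * 2 ^ j) * (A.card + 30 * Nat.sqrt (3 * 2 ^ j)) := by
  classical
  have : CharP K p := charP_of_injective_algebraMap (algebraMap (ZMod p) K).injective p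
  let φ : ZMod p × ZMod p × ZMod p → LightLine K := fun s => ofPoint (twistPoint lam s)
  let ψ : ZMod p × ZMod p × ZMod p → LightLine K := fun t => ofPlane (twistPlane lam t)
  have hφ : Function.Injective φ := fun s s' h =>
    twistPoint_x_injective hlam (congrArg LightLine.x h)
  have hψ : Function.Injective ψ := fun s s' h =>
    twistPlane_x_injective hlam (congrArg LightLine.x h)
  have hskew : Skew (S.image φ) := by
    intro l hl l' hl' hne
    obtain ⟨s, -, rfl⟩ := Finset.mem_image.1 hl
    obtain ⟨s', -, rfl⟩ := Finset.mem_image.1 hl'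
    exact twistPoint_skew hlam fun h => hne (by rw [h])
  have hSx : Set.InjOn LightLine.x ((S.image φ : Finset (LightLine K)) : Set (LightLine K)) := by
    intro l hl l' hl' h
    obtain ⟨s, -, rfl⟩ := Finset.mem_image.1 hl
    obtain ⟨s', -, rfl⟩ := Finset.mem_image.1 hl'
    exact congrArg φ (twistPoint_x_injective hlam h)
  have hTx : Set.InjOn LightLine.x ((T.image ψ : Finset (LightLine K)) : Set (LightLine K)) := by
    intro l hl l' hl' h
    obtain ⟨s, -, rfl⟩ := Finset.mem_image.1 hl
    obtain ⟨s', -, rfl⟩ := Finset.mem_image.1 hl'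
    exact congrArg ψ (twistPlane_x_injective hlam h)
  have hpencil : PencilBound (S.image φ) (T.image ψ) A.card := by
    intro l hl α β
    obtain ⟨t, -, rfl⟩ := Finset.mem_image.1 hl
    rw [Finset.filter_image, Finset.card_image_of_injective _ hφ]
    by_cases hα : α = 0
    · refine Finset.card_le_card_of_injOn (fun s => s.1)
        (fun s hs => (hS s (Finset.mem_filter.1 hs).1).1) ?_
      intro s hs s' hs' h
      obtain ⟨-, h1, h2⟩ := Finset.mem_filter.1 hs
      obtain ⟨-, h1', h2'⟩ := Finset.mem_filter.1 hs'
      exact twist_pencil hlam t α β ((twist_meets_iff hlam s t).1 h1)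
        ((twist_meets_iff hlam s' t).1 h1') h2 h2' (Or.inl ⟨hα, h⟩)
    · refine Finset.card_le_card_of_injOn (fun s => s.2.1)
        (fun s hs => (hS s (Finset.mem_filter.1 hs).1).2) ?_
      intro s hs s' hs' h
      obtain ⟨-, h1, h2⟩ := Finset.mem_filter.1 hs
      obtain ⟨-, h1', h2'⟩ := Finset.mem_filter.1 hs'
      exact twist_pencil hlam t α β ((twist_meets_iff hlam s t).1 h1)
        ((twist_meets_iff hlam s' t).1 h1') h2 h2' (Or.inr ⟨hα, h⟩)
  have hmain := meetCount_le_of_card_le_two_pow p A.card j hskew hSx hTx hpencil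
    (by rwa [Finset.card_image_of_injective _ hφ]) hp
  rw [Finset.card_image_of_injective _ hψ] at hmain
  refine le_of_eq_of_le ?_ hmain
  rw [meetCount, Finset.sum_image fun _ _ _ _ h => hψ h, Finset.card_filter,
    Finset.sum_product_right]
  refine Finset.sum_congr rfl fun t _ => ?_
  rw [← Finset.card_filter, Finset.filter_image, Finset.card_image_of_injective _ hφ]
  exact congrArg Finset.card (Finset.filter_congr fun s _ => (twist_meets_iff hlam s t).symm)

/-- An incidence bound for points and planes over `𝔽_p`: here the point `s` is incident to the
polar plane of `t`. -/
theorem card_incidences_le (p : ℕ) [Fact p.Prime] (A : Finset (ZMod p))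
    (S T : Finset (ZMod p × ZMod p × ZMod p)) (hS : ∀ s ∈ S, s.1 ∈ A ∧ s.2.1 ∈ A) (j : ℕ)
    (hj : S.card ≤ 2 ^ j) (hp : 6 * Nat.sqrt (3 * 2 ^ j) < p) :
    ((S ×ˢ T).filter fun q =>
      q.1.2.2 - q.2.2.2 + (q.1.1 * q.2.2.1 - q.2.1 * q.1.2.1) = 0).card ≤
    (T.card + 540 * j * 2 ^ j) * (A.card + 30 * Nat.sqrt (3 * 2 ^ j)) :=
  card_incidences_le_of_transcendental p
    ((transcendental_algebraMap_iff (IsFractionRing.injective (Polynomial (ZMod p))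
      (FractionRing (Polynomial (ZMod p))))).2 (Polynomial.transcendental_X (ZMod p)))
    A S T hS j hj hp

section Convolution

variable {G : Type*} [AddCommGroup G] [Fintype G]

/-- The number of representations as a difference, weighted by `ν`. -/
def diffConv (ν : G → ℕ) (s : G) : ℕ := ∑ y, ν (s + y) * ν y

/-- The total weight of the differences of `B`. -/
def diffEnergy (ν : G → ℕ) (B : Finset G) : ℕ := ∑ β ∈ B, ∑ γ ∈ B, diffConv ν (γ - β)

end Convolution

/-- The number of representations as the square of a difference of elements of `A`. -/
def sqRep {p : ℕ} (A : Finset (ZMod p)) (x : ZMod p) : ℕ :=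
  ((A ×ˢ A).filter fun q => (q.1 - q.2) ^ 2 = x).card

theorem diffConv_sqRep (p : ℕ) [Fact p.Prime] (A : Finset (ZMod p)) (s : ZMod p) :
    diffConv (sqRep A) s = (((A ×ˢ A) ×ˢ (A ×ˢ A)).filter fun q =>
      (q.1.1 - q.1.2) ^ 2 = s + (q.2.1 - q.2.2) ^ 2).card := by
  have h : ∀ y, sqRep A (s + y) * sqRep A y = ((((A ×ˢ A) ×ˢ (A ×ˢ A)).filter fun q =>
      (q.1.1 - q.1.2) ^ 2 = s + (q.2.1 - q.2.2) ^ 2).filter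
        fun q => (q.2.1 - q.2.2) ^ 2 = y).card := by
    intro y
    rw [sqRep, sqRep, ← Finset.card_product, ← Finset.filter_product, Finset.filter_filter]
    refine congrArg Finset.card (Finset.filter_congr fun q _ => ?_)
    constructor
    · rintro ⟨h1, h2⟩
      exact ⟨by rw [h1, h2], h2⟩
    · rintro ⟨h1, h2⟩
      exact ⟨by rw [h1, h2], h2⟩
  rw [diffConv, Finset.sum_congr rfl fun y _ => h y]
  exact (Finset.card_eq_sum_card_fiberwise fun _ _ => Finset.mem_coe.2 (Finset.mem_univ _)).symm

theorem diffEnergy_sqRep_le (p : ℕ) [Fact p.Prime] (hp2 : p ≠ 2) (A B : Finset (ZMod p)) (j : ℕ)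
    (hj : A.card ^ 2 * B.card ≤ 2 ^ j) (hp : 6 * Nat.sqrt (3 * 2 ^ j) < p) :
    diffEnergy (sqRep A) B ≤
      (A.card ^ 2 * B.card + 540 * j * 2 ^ j) * (A.card + 30 * Nat.sqrt (3 * 2 ^ j)) := by
  classical
  have h2 : (2 : ZMod p) ≠ 0 := by
    intro h
    have h' : ((2 : ℕ) : ZMod p) = 0 := by exact_mod_cast h
    rw [ZMod.natCast_eq_zero_iff] at h'
    exact hp2 ((Nat.prime_dvd_prime_iff_eq (Fact.out : p.Prime) Nat.prime_two).1 h')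
  let φ : ZMod p × ZMod p × ZMod p → ZMod p × ZMod p × ZMod p := fun s =>
    (s.1, s.2.1, (s.2.1 ^ 2 - s.1 ^ 2 - s.2.2) / 2)
  let ψ : ZMod p × ZMod p × ZMod p → ZMod p × ZMod p × ZMod p := fun s =>
    (s.1, s.2.1, (s.2.1 ^ 2 - s.1 ^ 2 - s.2.2) / 2)
  have hφ : Function.Injective φ := by
    rintro ⟨a, b, z⟩ ⟨a', b', z'⟩ h
    simp only [φ, Prod.mk.injEq] at h
    obtain ⟨rfl, rfl, h⟩ := h
    field_simp at h
    have : z = z' := by linear_combination -h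
    rw [this]
  let S := (A ×ˢ A ×ˢ B).image φ
  have hScard : S.card = A.card ^ 2 * B.card := by
    rw [Finset.card_image_of_injective _ hφ, Finset.card_product, Finset.card_product]
    ring
  have hmain := card_incidences_le p A S S (by
    intro s hs
    obtain ⟨q, hq, rfl⟩ := Finset.mem_image.1 hs
    simp only [Finset.mem_product] at hq
    exact ⟨hq.1, hq.2.1⟩) j (hScard.le.trans hj) hp
  rw [hScard] at hmain
  refine le_trans ?_ hmain
  let U := ((B ×ˢ B) ×ˢ ((A ×ˢ A) ×ˢ (A ×ˢ A))).filter fun q =>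
    (q.2.1.1 - q.2.1.2) ^ 2 = q.1.2 - q.1.1 + (q.2.2.1 - q.2.2.2) ^ 2
  have hU : diffEnergy (sqRep A) B = U.card := by
    have h : U.card = ∑ q ∈ B ×ˢ B, diffConv (sqRep A) (q.2 - q.1) := by
      rw [Finset.card_filter, Finset.sum_product]
      refine Finset.sum_congr rfl fun q _ => ?_
      rw [diffConv_sqRep, Finset.card_filter]
    rw [h, Finset.sum_product, diffEnergy]
  rw [hU]
  refine Finset.card_le_card_of_injOn
    (fun q => (φ (q.2.1.1, q.2.2.2, q.1.1), φ (q.2.2.1, q.2.1.2, q.1.2))) ?_ ?_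
  · rintro ⟨⟨β, γ⟩, ⟨a, b'⟩, ⟨a', b⟩⟩ hq
    rw [Finset.mem_coe, Finset.mem_filter] at hq
    simp only [Finset.mem_product] at hq
    obtain ⟨⟨⟨hβ, hγ⟩, ⟨ha, hb'⟩, ha', hb⟩, he⟩ := hq
    refine Finset.mem_coe.2 (Finset.mem_filter.2 ⟨Finset.mem_product.2
      ⟨Finset.mem_image_of_mem _ (by simp [*]), Finset.mem_image_of_mem _ (by simp [*])⟩, ?_⟩)
    simp only [φ]
    field_simp
    linear_combination -he
  · rintro ⟨⟨β, γ⟩, ⟨a, b'⟩, ⟨a', b⟩⟩ - ⟨⟨β₁, γ₁⟩, ⟨a₁, b₁'⟩, ⟨a₁', b₁⟩⟩ - he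
    simp only [Prod.mk.injEq] at he
    have e1 := hφ he.1
    have e2 := hφ he.2
    simp only [Prod.mk.injEq] at e1 e2
    obtain ⟨rfl, rfl, rfl⟩ := e1
    obtain ⟨rfl, rfl, rfl⟩ := e2
    rfl

end

section Convolution

variable {G : Type*} [AddCommGroup G] [Fintype G]

theorem sum_diffConv (ν : G → ℕ) : ∑ s, diffConv ν s = (∑ x, ν x) ^ 2 := by
  simp only [diffConv]
  rw [Finset.sum_comm, sq, Finset.sum_mul_sum]
  conv_rhs => rw [Finset.sum_comm]
  refine Finset.sum_congr rfl fun y _ => ?_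
  exact Fintype.sum_equiv (Equiv.addRight y) _ _ fun s => rfl

theorem sum_mul_eq_diffConv (ν : G → ℕ) (x x' : G) :
    ∑ y, ν (x + y) * ν (x' + y) = diffConv ν (x - x') := by
  rw [diffConv]
  refine Fintype.sum_equiv (Equiv.addLeft x') _ _ fun y => ?_
  simp only [Equiv.coe_addLeft]
  congr 2
  abel

theorem sum_mul_sub_eq_diffConv (ν : G → ℕ) (x x' : G) :
    ∑ y, ν (x - y) * ν (x' - y) = diffConv ν (x - x') := by
  rw [← sum_mul_eq_diffConv]
  refine Fintype.sum_equiv (Equiv.neg G) _ _ fun y => ?_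
  simp only [Equiv.neg_apply, sub_eq_add_neg]

theorem sum_diffConv_mul_card [DecidableEq G] (ν : G → ℕ) (B : Finset G) :
    ∑ α, diffConv ν α * (B.filter fun γ => γ - α ∈ B).card = diffEnergy ν B := by
  have h : ∀ α, diffConv ν α * (B.filter fun γ => γ - α ∈ B).card =
      ∑ γ ∈ B, if γ - α ∈ B then diffConv ν α else 0 := by
    intro α
    rw [Finset.card_filter, Finset.mul_sum]
    exact Finset.sum_congr rfl fun γ _ => by split_ifs <;> simp
  rw [Finset.sum_congr rfl fun α _ => h α, Finset.sum_comm, diffEnergy]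
  conv_rhs => rw [Finset.sum_comm]
  refine Finset.sum_congr rfl fun γ _ => ?_
  rw [← Finset.sum_filter]
  refine Finset.sum_nbij' (fun α => γ - α) (fun β => γ - β) ?_ ?_ ?_ ?_ ?_ <;>
    simp

theorem sq_sum_diffConv_le (ν : G → ℕ) (S : Finset G) :
    (∑ s ∈ S, diffConv ν s) ^ 2 ≤ (∑ x, ν x ^ 2) * diffEnergy ν S := by
  have h1 : ∑ s ∈ S, diffConv ν s = ∑ y, ν y * ∑ s ∈ S, ν (s + y) := by
    simp only [diffConv, Finset.mul_sum]
    rw [Finset.sum_comm]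
    exact Finset.sum_congr rfl fun y _ => Finset.sum_congr rfl fun s _ => mul_comm _ _
  have h2 : ∑ y, (∑ s ∈ S, ν (s + y)) ^ 2 = diffEnergy ν S := by
    simp only [sq, Finset.sum_mul_sum, diffEnergy, ← sum_mul_eq_diffConv]
    rw [Finset.sum_comm]
    conv_rhs => rw [Finset.sum_comm]
    refine Finset.sum_congr rfl fun s _ => ?_
    rw [Finset.sum_comm]
  rw [h1, ← h2]
  exact Finset.sum_mul_sq_le_sq_mul_sq _ _ _

/-- The number of weighted quadruples with prescribed differences. -/
def quadConv (ν : G → ℕ) (q : G × G × G) : ℕ :=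
  ∑ x, ν x * ν (x - q.1) * (ν (x - q.2.2 + q.2.1) * ν (x - q.2.2))

theorem sum_quadConv (ν : G → ℕ) (α δ : G) :
    ∑ γ, quadConv ν (α, δ, γ) = diffConv ν α * diffConv ν δ := by
  simp only [quadConv]
  rw [Finset.sum_comm, diffConv, Finset.sum_mul]
  refine Fintype.sum_equiv (Equiv.subRight α) _ _ fun x => ?_
  rw [← Finset.mul_sum, Equiv.subRight_apply]
  congr 1
  · rw [add_sub_cancel]
  · rw [diffConv]
    refine Fintype.sum_equiv (Equiv.subLeft x) _ _ fun γ => ?_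
    rw [Equiv.subLeft_apply, add_comm]

theorem sum_quadConv_sq (ν : G → ℕ) : ∑ q, quadConv ν q ^ 2 = ∑ s, diffConv ν s ^ 4 := by
  have h1 : ∀ q, quadConv ν q ^ 2 = ∑ x, ∑ x', (ν x * ν x') *
      ((ν (x - q.1) * ν (x' - q.1)) * ((ν (x - q.2.2 + q.2.1) * ν (x' - q.2.2 + q.2.1)) *
        (ν (x - q.2.2) * ν (x' - q.2.2)))) := by
    intro q
    rw [quadConv, sq, Finset.sum_mul_sum]
    exact Finset.sum_congr rfl fun x _ => Finset.sum_congr rfl fun x' _ => by ring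
  rw [Finset.sum_congr rfl fun q _ => h1 q, Finset.sum_comm]
  have h2 : ∀ x x' : G, ∑ q : G × G × G, (ν x * ν x') *
      ((ν (x - q.1) * ν (x' - q.1)) * ((ν (x - q.2.2 + q.2.1) * ν (x' - q.2.2 + q.2.1)) *
        (ν (x - q.2.2) * ν (x' - q.2.2)))) = ν x * ν x' * diffConv ν (x - x') ^ 3 := by
    intro x x'
    rw [← Finset.mul_sum, Fintype.sum_prod_type]
    simp only [← Finset.mul_sum]
    rw [← Finset.sum_mul, sum_mul_sub_eq_diffConv, Fintype.sum_prod_type, Finset.sum_comm]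
    simp only [← Finset.sum_mul, sum_mul_eq_diffConv]
    simp only [sub_sub_sub_cancel_right]
    rw [← Finset.mul_sum, sum_mul_sub_eq_diffConv]
    ring
  have h3 : ∑ x, ∑ x', ν x * ν x' * diffConv ν (x - x') ^ 3 = ∑ s, diffConv ν s ^ 4 := by
    rw [Finset.sum_comm]
    have h4 : ∀ s, diffConv ν s ^ 4 = ∑ x', ν (s + x') * ν x' * diffConv ν s ^ 3 := by
      intro s
      rw [← Finset.sum_mul, ← diffConv]
      ring
    rw [Finset.sum_congr rfl fun s _ => h4 s]
    conv_rhs => rw [Finset.sum_comm]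
    refine Finset.sum_congr rfl fun x' _ => ?_
    refine Fintype.sum_equiv (Equiv.subRight x') _ _ fun x => ?_
    rw [Equiv.subRight_apply, sub_add_cancel]
  rw [← h3]
  refine Finset.sum_congr rfl fun x _ => ?_
  rw [Finset.sum_comm]
  exact Finset.sum_congr rfl fun x' _ => h2 x x'

theorem diffConv_pos_of_ne_zero {ν : G → ℕ} {x y : G} (hx : ν x ≠ 0) (hy : ν y ≠ 0) :
    0 < diffConv ν (x - y) := by
  rw [diffConv]
  refine lt_of_lt_of_le ?_ (Finset.single_le_sum (fun _ _ => Nat.zero_le _) (Finset.mem_univ y))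
  rw [sub_add_cancel]
  exact Nat.mul_pos (Nat.pos_of_ne_zero hx) (Nat.pos_of_ne_zero hy)

/-- A quadruple with differences `α, δ, γ` forces further differences to be popular. -/
theorem mem_of_quadConv_ne_zero [DecidableEq G] {ν : G → ℕ} {Q : Finset G}
    (hQ : ∀ s, 0 < diffConv ν s → s ∈ Q)
    {α δ γ : G} (h : quadConv ν (α, δ, γ) ≠ 0) :
    γ ∈ (Q.filter fun γ => γ - α ∈ Q).filter fun γ => γ - δ ∈ Q.filter fun γ => γ - α ∈ Q := by
  obtain ⟨x, -, hx⟩ := Finset.exists_ne_zero_of_sum_ne_zero h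
  simp only [mul_ne_zero_iff] at hx
  obtain ⟨⟨h1, h2⟩, h3, h4⟩ := hx
  have e1 := hQ _ (diffConv_pos_of_ne_zero h1 h4)
  have e2 := hQ _ (diffConv_pos_of_ne_zero h2 h4)
  have e3 := hQ _ (diffConv_pos_of_ne_zero h1 h3)
  have e4 := hQ _ (diffConv_pos_of_ne_zero h2 h3)
  simp only [Finset.mem_filter]
  refine ⟨⟨?_, ?_⟩, ?_, ?_⟩
  · convert e1 using 1; abel
  · convert e2 using 1; abel
  · convert e3 using 1; abel
  · convert e4 using 1; abel

end Convolution

theorem pow_four_le_sum_Icc (n : ℕ) : n ^ 4 ≤ ∑ t ∈ Finset.Icc 1 n, 4 * t ^ 3 := by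
  induction n with
  | zero => simp
  | succ n ih =>
    rw [Finset.sum_Icc_succ_top (by omega)]
    have : (n + 1) ^ 4 ≤ n ^ 4 + 4 * (n + 1) ^ 3 := by ring_nf; omega
    omega

section Popular

variable {G : Type*} [AddCommGroup G] [Fintype G]

theorem pow_four_mul_card_le {ν : G → ℕ} {N : ℕ} (h2 : ∑ x, ν x ^ 2 ≤ 2 * N ^ 3) {M : ℝ}
    {S : Finset G} (hE : (diffEnergy ν S : ℝ) ≤ M * S.card * √S.card) {t : ℕ}
    (ht : ∀ s ∈ S, t ≤ diffConv ν s) : (t : ℝ) ^ 4 * S.card ≤ 4 * N ^ 6 * M ^ 2 := by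
  have h3 : t * S.card ≤ ∑ s ∈ S, diffConv ν s := by
    have := Finset.card_nsmul_le_sum S _ t ht
    rwa [smul_eq_mul, mul_comm] at this
  have h4 : ((t : ℝ) * S.card) ^ 2 ≤ 2 * N ^ 3 * (M * S.card * √S.card) := by
    have h5 := (Nat.pow_le_pow_left h3 2).trans ((sq_sum_diffConv_le ν S).trans
      (Nat.mul_le_mul_right _ h2))
    have h6 : ((t : ℝ) * S.card) ^ 2 ≤ 2 * N ^ 3 * diffEnergy ν S := by exact_mod_cast h5
    exact h6.trans (mul_le_mul_of_nonneg_left hE (by positivity))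
  have hu2 : (S.card : ℝ) = √S.card ^ 2 := (Real.sq_sqrt (Nat.cast_nonneg _)).symm
  have hu0 : 0 ≤ √(S.card : ℝ) := Real.sqrt_nonneg _
  generalize √(S.card : ℝ) = u at h4 hu2 hu0
  rw [hu2] at h4 ⊢
  rcases hu0.eq_or_lt with h0 | h0
  · rw [← h0]
    simp only [ne_eq, OfNat.ofNat_ne_zero, not_false_eq_true, zero_pow, mul_zero]
    positivity
  · have h5 : (t : ℝ) ^ 2 * u ≤ 2 * N ^ 3 * M := by
      refine le_of_mul_le_mul_right ?_ (pow_pos h0 3)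
      calc (t : ℝ) ^ 2 * u * u ^ 3 = (t * u ^ 2) ^ 2 := by ring
        _ ≤ _ := h4
        _ = _ := by ring
    calc (t : ℝ) ^ 4 * u ^ 2 = (t ^ 2 * u) ^ 2 := by ring
      _ ≤ (2 * N ^ 3 * M) ^ 2 := pow_le_pow_left₀ (by positivity) h5 2
      _ = _ := by ring

theorem sum_diffConv_pow_four_le {ν : G → ℕ} {Q : Finset G}
    (hQ : ∀ s, 0 < diffConv ν s → s ∈ Q) {N : ℕ} {M : ℝ}
    (hE : ∀ B ⊆ Q, (diffEnergy ν B : ℝ) ≤ M * B.card * √B.card)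
    (h1 : ∑ x, ν x = N ^ 2) (h2 : ∑ x, ν x ^ 2 ≤ 2 * N ^ 3) :
    (∑ s, (diffConv ν s : ℝ) ^ 4) ≤ 16 * N ^ 6 * M ^ 2 * (1 + Real.log (N ^ 4 : ℕ)) := by
  have hle : ∀ s, diffConv ν s ≤ N ^ 4 := by
    intro s
    calc diffConv ν s ≤ ∑ s, diffConv ν s :=
          Finset.single_le_sum (fun _ _ => Nat.zero_le _) (Finset.mem_univ s)
      _ = N ^ 4 := by rw [sum_diffConv, h1]; ring
  have h3 : ∀ s, (diffConv ν s : ℝ) ^ 4 ≤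
      ∑ t ∈ Finset.Icc 1 (N ^ 4), if t ≤ diffConv ν s then 4 * (t : ℝ) ^ 3 else 0 := by
    intro s
    rw [← Finset.sum_filter]
    have h4 : (Finset.Icc 1 (N ^ 4)).filter (fun t => t ≤ diffConv ν s) =
        Finset.Icc 1 (diffConv ν s) := by
      ext t
      have := hle s
      simp only [Finset.mem_filter, Finset.mem_Icc]
      omega
    rw [h4]
    exact_mod_cast pow_four_le_sum_Icc (diffConv ν s)
  refine (Finset.sum_le_sum fun s _ => h3 s).trans ?_
  rw [Finset.sum_comm]
  have h5 : ∀ t ∈ Finset.Icc 1 (N ^ 4),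
      (∑ s, if t ≤ diffConv ν s then 4 * (t : ℝ) ^ 3 else 0) ≤
        16 * N ^ 6 * M ^ 2 * (t : ℝ)⁻¹ := by
    intro t ht
    have ht1 := (Finset.mem_Icc.1 ht).1
    have ht0 : (0 : ℝ) < t := by exact_mod_cast ht1
    rw [← Finset.sum_filter, Finset.sum_const, nsmul_eq_mul]
    have h6 := pow_four_mul_card_le h2 (S := Finset.univ.filter fun s => t ≤ diffConv ν s)
      (hE _ fun s hs => hQ s (lt_of_lt_of_le ht1 (Finset.mem_filter.1 hs).2))
      (fun s hs => (Finset.mem_filter.1 hs).2)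
    rw [← div_eq_mul_inv, le_div_iff₀ ht0]
    linarith
  refine (Finset.sum_le_sum h5).trans ?_
  rw [← Finset.mul_sum]
  refine mul_le_mul_of_nonneg_left ?_ (by positivity)
  have := harmonic_le_one_add_log (N ^ 4)
  rw [harmonic_eq_sum_Icc] at this
  push_cast at this ⊢
  exact this

/-- A good bound for the energy of all subsets of the set of differences forces this set to be
large. -/
theorem pow_forty_le [DecidableEq G] {ν : G → ℕ} {Q : Finset G}
    (hQ : ∀ s, 0 < diffConv ν s → s ∈ Q) {N : ℕ} {M : ℝ}
    (hE : ∀ B ⊆ Q, (diffEnergy ν B : ℝ) ≤ M * B.card * √B.card)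
    (hN : 0 < N) (h1 : ∑ x, ν x = N ^ 2) (h2 : ∑ x, ν x ^ 2 ≤ 2 * N ^ 3)
    (hM : 0 < M) :
    (N : ℝ) ^ 40 ≤ 2 ^ 26 * M ^ 9 * √Q.card ^ 17 * (1 + Real.log (N ^ 4 : ℕ)) ^ 2 := by
  have hN0 : (0 : ℝ) < N := by exact_mod_cast hN
  have hsum : (∑ s, (diffConv ν s : ℝ)) = N ^ 4 := by
    have : ∑ s, diffConv ν s = N ^ 4 := by rw [sum_diffConv, h1]; ring
    exact_mod_cast this
  have hsumQ : (∑ s ∈ Q, (diffConv ν s : ℝ)) = N ^ 4 := by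
    rw [← hsum]
    refine Finset.sum_subset (Finset.subset_univ _) fun s _ hs => ?_
    by_contra h
    exact hs (hQ s (Nat.pos_of_ne_zero fun h0 => h (by rw [h0, Nat.cast_zero])))
  obtain ⟨κ, hκ⟩ : ∃ κ, √(Q.card : ℝ) = κ := ⟨_, rfl⟩
  rw [hκ]
  have hκ2 : (Q.card : ℝ) = κ ^ 2 := by rw [← hκ, Real.sq_sqrt (Nat.cast_nonneg _)]
  have hκ0 : 0 < κ := by
    rw [← hκ, Real.sqrt_pos, Nat.cast_pos, Finset.card_pos]
    by_contra h
    rw [Finset.not_nonempty_iff_eq_empty.1 h, Finset.sum_empty] at hsumQ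
    have : (0 : ℝ) < N ^ 4 := by positivity
    linarith
  set D : ℝ := N ^ 4 / (4 * κ ^ 2) with hD
  have hD0 : 0 < D := by positivity
  set E : ℝ := M * κ ^ 3 with hEdef
  have hE0 : 0 < E := by positivity
  set τ : ℝ := 4 * E / N ^ 4 with hτ
  have hτ0 : 0 < τ := by positivity
  have hEQ : (diffEnergy ν Q : ℝ) ≤ E := by
    have := hE Q subset_rfl
    rw [hκ, hκ2] at this
    linarith [this, hEdef]
  let R : G → Finset G := fun α => Q.filter fun γ => γ - α ∈ Q
  have hRQ : ∀ α, R α ⊆ Q := fun α => Finset.filter_subset _ _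
  have hRsum : ∑ α, (diffConv ν α : ℝ) * (R α).card = diffEnergy ν Q := by
    exact_mod_cast sum_diffConv_mul_card ν Q
  set P := Q.filter fun s => D ≤ diffConv ν s with hP
  set P' := P.filter fun α => ((R α).card : ℝ) ≤ τ with hP'
  have hPsum : 3 / 4 * (N : ℝ) ^ 4 ≤ ∑ s ∈ P, (diffConv ν s : ℝ) := by
    have h3 := Finset.sum_filter_add_sum_filter_not Q (fun s => D ≤ diffConv ν s)
      fun s => (diffConv ν s : ℝ)
    have h4 : ∑ s ∈ Q.filter (fun s => ¬ D ≤ diffConv ν s), (diffConv ν s : ℝ) ≤ 1 / 4 * N ^ 4 := by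
      refine (Finset.sum_le_card_nsmul _ _ D fun s hs =>
        (not_le.1 (Finset.mem_filter.1 hs).2).le).trans ?_
      rw [nsmul_eq_mul]
      have h5 : ((Q.filter fun s => ¬ D ≤ diffConv ν s).card : ℝ) ≤ κ ^ 2 := by
        rw [← hκ2]
        exact_mod_cast Finset.card_filter_le _ _
      calc _ ≤ κ ^ 2 * D := mul_le_mul_of_nonneg_right h5 hD0.le
        _ = _ := by rw [hD]; field_simp
    linarith
  have hP'sum : 1 / 2 * (N : ℝ) ^ 4 ≤ ∑ s ∈ P', (diffConv ν s : ℝ) := by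
    have h3 := Finset.sum_filter_add_sum_filter_not P (fun α => ((R α).card : ℝ) ≤ τ)
      fun s => (diffConv ν s : ℝ)
    have h4 : ∑ s ∈ P.filter (fun α => ¬ ((R α).card : ℝ) ≤ τ), (diffConv ν s : ℝ) ≤
        1 / 4 * N ^ 4 := by
      have h5 : τ * ∑ s ∈ P.filter (fun α => ¬ ((R α).card : ℝ) ≤ τ), (diffConv ν s : ℝ) ≤ E := by
        rw [Finset.mul_sum]
        refine le_trans ?_ (hRsum.le.trans hEQ)
        refine le_trans (Finset.sum_le_sum fun s hs => ?_)
          (Finset.sum_le_sum_of_subset_of_nonneg (Finset.subset_univ _) fun _ _ _ =>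
            mul_nonneg (Nat.cast_nonneg _) (Nat.cast_nonneg _))
        rw [mul_comm]
        exact mul_le_mul_of_nonneg_left (not_le.1 (Finset.mem_filter.1 hs).2).le
          (Nat.cast_nonneg _)
      refine le_of_mul_le_mul_left (h5.trans_eq ?_) hτ0
      rw [hτ]
      field_simp
    linarith
  let Γ : Finset (G × G × G) := P'.biUnion fun α => P.biUnion fun δ =>
    ((R α).filter fun γ => γ - δ ∈ R α).image fun γ => (α, δ, γ)
  have hΓcard : (Γ.card : ℝ) ≤ ∑ α ∈ P', ∑ δ ∈ P, (((R α).filter fun γ => γ - δ ∈ R α).card : ℝ) := by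
    have : Γ.card ≤ ∑ α ∈ P', ∑ δ ∈ P, ((R α).filter fun γ => γ - δ ∈ R α).card := by
      refine Finset.card_biUnion_le.trans (Finset.sum_le_sum fun α _ => ?_)
      exact Finset.card_biUnion_le.trans (Finset.sum_le_sum fun δ _ => Finset.card_image_le)
    exact_mod_cast this
  have hpop : ∀ δ ∈ P, D ≤ diffConv ν δ := fun δ hδ => (Finset.mem_filter.1 hδ).2
  have hfibre : ∀ α ∈ P', D * ∑ δ ∈ P, (((R α).filter fun γ => γ - δ ∈ R α).card : ℝ) ≤
      M * √τ * (R α).card := by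
    intro α hα
    rw [Finset.mul_sum]
    have h3 : ∑ δ ∈ P, D * (((R α).filter fun γ => γ - δ ∈ R α).card : ℝ) ≤ diffEnergy ν (R α) := by
      have h4 : ∑ δ, (diffConv ν δ : ℝ) * ((R α).filter fun γ => γ - δ ∈ R α).card =
          diffEnergy ν (R α) := by exact_mod_cast sum_diffConv_mul_card ν (R α)
      rw [← h4]
      exact le_trans (Finset.sum_le_sum fun δ hδ =>
          mul_le_mul_of_nonneg_right (hpop δ hδ) (Nat.cast_nonneg _))
        (Finset.sum_le_sum_of_subset_of_nonneg (Finset.subset_univ _) fun _ _ _ =>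
            mul_nonneg (Nat.cast_nonneg _) (Nat.cast_nonneg _))
    refine h3.trans ((hE _ (hRQ α)).trans ?_)
    have h5 : √((R α).card : ℝ) ≤ √τ := Real.sqrt_le_sqrt (Finset.mem_filter.1 hα).2
    calc M * (R α).card * √(R α).card ≤ M * (R α).card * √τ :=
          mul_le_mul_of_nonneg_left h5 (mul_nonneg hM.le (Nat.cast_nonneg _))
      _ = _ := by ring
  have hΓ : D ^ 2 * Γ.card ≤ M * √τ * E := by
    calc D ^ 2 * Γ.card ≤ D ^ 2 *
          ∑ α ∈ P', ∑ δ ∈ P, (((R α).filter fun γ => γ - δ ∈ R α).card : ℝ) :=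
          mul_le_mul_of_nonneg_left hΓcard (by positivity)
      _ = D * ∑ α ∈ P', D * ∑ δ ∈ P, (((R α).filter fun γ => γ - δ ∈ R α).card : ℝ) := by
          rw [← Finset.mul_sum]; ring
      _ ≤ D * ∑ α ∈ P', M * √τ * (R α).card :=
          mul_le_mul_of_nonneg_left (Finset.sum_le_sum hfibre) hD0.le
      _ = M * √τ * ∑ α ∈ P', D * (R α).card := by
          rw [← Finset.mul_sum, ← Finset.mul_sum]; ring
      _ ≤ M * √τ * ∑ α, (diffConv ν α : ℝ) * (R α).card := by
          refine mul_le_mul_of_nonneg_left ?_ (by positivity)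
          exact le_trans (Finset.sum_le_sum fun α hα => mul_le_mul_of_nonneg_right
              (hpop α (Finset.mem_filter.1 hα).1) (Nat.cast_nonneg _))
            (Finset.sum_le_sum_of_subset_of_nonneg (Finset.subset_univ _) fun _ _ _ =>
            mul_nonneg (Nat.cast_nonneg _) (Nat.cast_nonneg _))
      _ ≤ M * √τ * E := by
          rw [hRsum]
          exact mul_le_mul_of_nonneg_left hEQ (by positivity)
  have hW : (∑ α ∈ P', (diffConv ν α : ℝ)) * ∑ δ ∈ P, (diffConv ν δ : ℝ) ≤
      ∑ q ∈ Γ, (quadConv ν q : ℝ) := by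
    have : (∑ α ∈ P', diffConv ν α) * ∑ δ ∈ P, diffConv ν δ ≤ ∑ q ∈ Γ, quadConv ν q := by
      rw [Finset.sum_mul_sum, ← Finset.sum_product']
      simp only [← sum_quadConv]
      rw [← Finset.sum_product' (P' ×ˢ P) Finset.univ
        fun x γ => quadConv ν (x.1, x.2, γ)]
      rw [← Finset.sum_filter_ne_zero]
      refine le_trans (le_of_eq (Finset.sum_image (f := fun q => quadConv ν q)
        (g := fun x : (G × G) × G => (x.1.1, x.1.2, x.2)) ?_).symm) (Finset.sum_le_sum_of_subset ?_)
      · rintro ⟨⟨a, b⟩, c⟩ - ⟨⟨a', b'⟩, c'⟩ - h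
        simp only [Prod.mk.injEq] at h ⊢
        tauto
      · intro q hq
        obtain ⟨⟨⟨α, δ⟩, γ⟩, hx, rfl⟩ := Finset.mem_image.1 hq
        obtain ⟨hx1, hx2⟩ := Finset.mem_filter.1 hx
        simp only [Finset.mem_product, Finset.mem_univ, and_true] at hx1
        exact Finset.mem_biUnion.2 ⟨α, hx1.1, Finset.mem_biUnion.2 ⟨δ, hx1.2,
          Finset.mem_image_of_mem _ (mem_of_quadConv_ne_zero hQ hx2)⟩⟩
    exact_mod_cast this
  have hW' : (N : ℝ) ^ 8 / 4 ≤ ∑ q ∈ Γ, (quadConv ν q : ℝ) := by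
    refine le_trans ?_ hW
    calc (N : ℝ) ^ 8 / 4 = (1 / 2 * N ^ 4) * (1 / 2 * N ^ 4) := by ring
      _ ≤ _ := mul_le_mul hP'sum (by linarith [pow_pos hN0 4]) (by positivity) (by positivity)
  have hCS : ((N : ℝ) ^ 8 / 4) ^ 2 ≤ Γ.card * ∑ s, (diffConv ν s : ℝ) ^ 4 := by
    refine (pow_le_pow_left₀ (by positivity) hW' 2).trans (sq_sum_le_card_mul_sum_sq.trans ?_)
    refine mul_le_mul_of_nonneg_left ?_ (Nat.cast_nonneg _)
    have h3 : ∑ q, (quadConv ν q : ℝ) ^ 2 = ∑ s, (diffConv ν s : ℝ) ^ 4 := by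
      exact_mod_cast sum_quadConv_sq ν
    rw [← h3]
    exact Finset.sum_le_sum_of_subset_of_nonneg (Finset.subset_univ _) fun _ _ _ => by positivity
  have h4 := sum_diffConv_pow_four_le hQ hE h1 h2
  set H := 1 + Real.log (N ^ 4 : ℕ) with hH
  have hH0 : 0 ≤ H := by
    have : 0 ≤ Real.log (N ^ 4 : ℕ) := Real.log_natCast_nonneg _
    linarith
  have h5 : D ^ 2 * ((N : ℝ) ^ 8 / 4) ^ 2 ≤ (M * √τ * E) * (16 * N ^ 6 * M ^ 2 * H) := by
    calc D ^ 2 * ((N : ℝ) ^ 8 / 4) ^ 2 ≤ D ^ 2 * (Γ.card * (16 * N ^ 6 * M ^ 2 * H)) :=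
          mul_le_mul_of_nonneg_left (hCS.trans (mul_le_mul_of_nonneg_left h4 (Nat.cast_nonneg _)))
            (by positivity)
      _ = D ^ 2 * Γ.card * (16 * N ^ 6 * M ^ 2 * H) := by ring
      _ ≤ _ := mul_le_mul_of_nonneg_right hΓ (by positivity)
  have h6 := pow_le_pow_left₀ (by positivity) h5 2
  have h7 : ((M * √τ * E) * (16 * N ^ 6 * M ^ 2 * H)) ^ 2 =
      1024 * N ^ 8 * M ^ 9 * κ ^ 9 * H ^ 2 := by
    have h8 : √τ ^ 2 = τ := Real.sq_sqrt hτ0.le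
    calc _ = M ^ 2 * √τ ^ 2 * E ^ 2 * (16 * N ^ 6 * M ^ 2 * H) ^ 2 := by ring
      _ = _ := by
        rw [h8, hτ, hEdef]
        field_simp
        ring
  have h8 : (D ^ 2 * ((N : ℝ) ^ 8 / 4) ^ 2) ^ 2 = N ^ 48 / (2 ^ 16 * κ ^ 8) := by
    rw [hD]
    field_simp
    ring
  rw [h7, h8, div_le_iff₀ (by positivity)] at h6
  refine le_of_mul_le_mul_right ?_ (pow_pos hN0 8)
  calc (N : ℝ) ^ 40 * N ^ 8 = N ^ 48 := by ring
    _ ≤ _ := h6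
    _ = _ := by ring

end Popular

theorem sum_sqRep (p : ℕ) [Fact p.Prime] (A : Finset (ZMod p)) :
    ∑ x, sqRep A x = A.card ^ 2 := by
  rw [sq, ← Finset.card_product]
  exact (Finset.card_eq_sum_card_fiberwise fun _ _ => Finset.mem_coe.2 (Finset.mem_univ _)).symm

theorem sum_sqRep_sq_le (p : ℕ) [Fact p.Prime] (A : Finset (ZMod p)) :
    ∑ x, sqRep A x ^ 2 ≤ 2 * A.card ^ 3 := by
  have h : ∑ x, sqRep A x ^ 2 = diffConv (sqRep A) 0 := by
    simp only [diffConv, zero_add, sq]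
  have hc : (A ×ˢ A ×ˢ A ×ˢ (Finset.univ : Finset Bool)).card = 2 * A.card ^ 3 := by
    simp only [Finset.card_product, Finset.card_univ, Fintype.card_bool]
    ring
  rw [h, diffConv_sqRep, ← hc]
  refine Finset.card_le_card_of_injOn
    (fun q => (q.1.1, q.1.2, q.2.1, decide (q.2.1 - q.2.2 = q.1.1 - q.1.2))) ?_ ?_
  · rintro ⟨⟨a, b⟩, c, d⟩ hq
    rw [Finset.mem_coe, Finset.mem_filter] at hq
    simp only [Finset.mem_product] at hq
    simp only [Finset.coe_product, Set.mem_prod, Finset.mem_coe, hq.1.1.1, hq.1.1.2, hq.1.2.1,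
      Finset.mem_univ, and_self]
  · rintro ⟨⟨a, b⟩, c, d⟩ hq ⟨⟨a', b'⟩, c', d'⟩ hq' he
    have e1 := (Finset.mem_filter.1 hq).2
    have e2 := (Finset.mem_filter.1 hq').2
    simp only [Prod.mk.injEq, decide_eq_decide] at he e1 e2
    obtain ⟨rfl, rfl, rfl, he⟩ := he
    rw [zero_add, sq_eq_sq_iff_eq_or_eq_neg] at e1 e2
    have : d = d' := by
      by_cases hd : c - d = a - b
      · linear_combination he.1 hd - hd
      · have e3 := e1.resolve_left fun h => hd h.symm
        have e4 := e2.resolve_left fun h => hd (he.2 h.symm)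
        linear_combination e4 - e3
    rw [this]

theorem mem_of_diffConv_sqRep_pos (p : ℕ) [Fact p.Prime] (A : Finset (ZMod p)) (s : ZMod p)
    (h : 0 < diffConv (sqRep A) s) :
    s ∈ ((A - A).image fun x => x ^ 2) - ((A - A).image fun x => x ^ 2) := by
  rw [diffConv_sqRep, Finset.card_pos] at h
  obtain ⟨⟨⟨a, b⟩, c, d⟩, hq⟩ := h
  obtain ⟨h1, h2⟩ := Finset.mem_filter.1 hq
  simp only [Finset.mem_product] at h1 h2
  have : s = (a - b) ^ 2 - (c - d) ^ 2 := by rw [h2]; ring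
  rw [this]
  exact Finset.sub_mem_sub
    (Finset.mem_image_of_mem _ (Finset.sub_mem_sub h1.1.1 h1.1.2))
    (Finset.mem_image_of_mem _ (Finset.sub_mem_sub h1.2.1 h1.2.2))

theorem two_pow_clog_le {n : ℕ} (hn : n ≠ 0) : 2 ^ Nat.clog 2 n ≤ 2 * n := by
  rcases Nat.lt_or_ge 1 n with h | h
  · have h1 := Nat.pow_pred_clog_lt_self Nat.one_lt_two h
    have h2 := Nat.clog_pos Nat.one_lt_two h
    obtain ⟨j, hj⟩ : ∃ j, Nat.clog 2 n = j + 1 := ⟨_, (Nat.sub_add_cancel h2).symm⟩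
    rw [hj, Nat.pred_succ] at h1
    rw [hj, pow_succ]
    omega
  · obtain rfl : n = 1 := by omega
    simp

/-- The energy bound, with the size of the set entering through its three halves power. -/
theorem diffEnergy_sqRep_le_sqrt (p : ℕ) [Fact p.Prime] (hp2 : p ≠ 2) (A B : Finset (ZMod p))
    (K : ℕ) (hB : B.card ≤ K) (hp : 216 * (A.card ^ 2 * K) < p ^ 2) :
    (diffEnergy (sqRep A) B : ℝ) ≤
      76 * (1080 * Nat.clog 2 (A.card ^ 2 * K) + 1) * A.card ^ 3 * B.card * √B.card := by
  rcases Finset.eq_empty_or_nonempty B with rfl | hB0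
  · simp [diffEnergy]
  rcases Nat.eq_zero_or_pos A.card with hA | hA
  · have h0 : ∀ x, sqRep A x = 0 := by
      rw [Finset.card_eq_zero] at hA
      simp [sqRep, hA]
    have h1 : diffEnergy (sqRep A) B = 0 := by simp [diffEnergy, diffConv, h0]
    rw [h1, Nat.cast_zero]
    positivity
  set N := A.card with hN
  set b := B.card with hb
  have hb1 : 1 ≤ b := Finset.card_pos.2 hB0
  set n := N ^ 2 * b with hn
  have hnK : n ≤ N ^ 2 * K := Nat.mul_le_mul_left _ hB
  have hn0 : n ≠ 0 := by positivity
  set j := Nat.clog 2 n with hj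
  have hjn : 2 ^ j ≤ 2 * n := two_pow_clog_le hn0
  have hjJ : j ≤ Nat.clog 2 (N ^ 2 * K) := Nat.clog_mono_right 2 hnK
  set r := Nat.sqrt (3 * 2 ^ j) with hr
  have hr2 : r * r ≤ 6 * n := (Nat.sqrt_le _).trans (by omega)
  have hmain := diffEnergy_sqRep_le p hp2 A B j (Nat.le_pow_clog Nat.one_lt_two _) (by
    rw [← hr]
    by_contra hlt
    have h3 : p ^ 2 ≤ (6 * r) ^ 2 := Nat.pow_le_pow_left (by omega) 2
    nlinarith)
  rw [← hN, ← hb, ← hn, ← hr] at hmain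
  have h4 : (diffEnergy (sqRep A) B : ℝ) ≤ (n + 540 * j * 2 ^ j) * (N + 30 * r) := by
    exact_mod_cast hmain
  set u := √(b : ℝ) with hu
  have hu2 : u ^ 2 = b := Real.sq_sqrt (Nat.cast_nonneg _)
  have hu1 : 1 ≤ u := by
    rw [hu, Real.one_le_sqrt]
    exact_mod_cast hb1
  have hnr : (n : ℝ) = N ^ 2 * b := by rw [hn]; push_cast; ring
  have h5 : (r : ℝ) ≤ 5 / 2 * (N * u) := by
    have h6 : (r : ℝ) * r ≤ 6 * n := by exact_mod_cast hr2
    refine le_of_sq_le_sq ?_ (by positivity)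
    have h7 : (5 / 2 * (N * u)) ^ 2 = 25 / 4 * (n : ℝ) := by rw [hnr, ← hu2]; ring
    rw [h7]
    nlinarith [(Nat.cast_nonneg n : (0 : ℝ) ≤ n)]
  have h6 : (N : ℝ) + 30 * r ≤ 76 * (N * u) := by
    have : (N : ℝ) ≤ N * u := le_mul_of_one_le_right (Nat.cast_nonneg _) hu1
    linarith
  have h7 : (n : ℝ) + 540 * j * 2 ^ j ≤ (1080 * Nat.clog 2 (N ^ 2 * K) + 1) * n := by
    have h8 : (j : ℝ) ≤ Nat.clog 2 (N ^ 2 * K) := by exact_mod_cast hjJ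
    have h9 : (2 : ℝ) ^ j ≤ 2 * n := by exact_mod_cast hjn
    have h10 := mul_le_mul h8 h9 (by positivity) (by positivity)
    linarith
  refine (h4.trans (mul_le_mul h7 h6 (by positivity) (by positivity))).trans_eq ?_
  rw [hnr]
  ring

/-- The quantitative conclusion for a set satisfying the size restriction. -/
theorem pow_card_le_mul_card (p : ℕ) [Fact p.Prime] (hp2 : p ≠ 2) (A : Finset (ZMod p))
    (hA : 0 < A.card) (K : ℕ)
    (hK : K = (((A - A).image fun x => x ^ 2) - ((A - A).image fun x => x ^ 2)).card)
    (hp : 216 * (A.card ^ 2 * K) < p ^ 2) (hKA : K ≤ A.card ^ 4) {x : ℝ} (hx : 1 ≤ x)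
    (hxA : (A.card : ℝ) = x ^ 100) :
    x ^ 151 ≤ (2 ^ 26 * 10 ^ 78) * K := by
  have hN0 : (0 : ℝ) < A.card := by exact_mod_cast hA
  have hx0 : 0 < x := by linarith
  set J := Nat.clog 2 (A.card ^ 2 * K) with hJ
  have hmain := pow_forty_le (ν := sqRep A)
    (Q := ((A - A).image fun x => x ^ 2) - ((A - A).image fun x => x ^ 2))
    (mem_of_diffConv_sqRep_pos p A) (N := A.card) (M := 76 * (1080 * J + 1) * A.card ^ 3)
    (fun B hB => diffEnergy_sqRep_le_sqrt p hp2 A B K (hK ▸ Finset.card_le_card hB) hp)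
    hA (sum_sqRep p A) (sum_sqRep_sq_le p A) (by positivity)
  rw [← hK] at hmain
  have hlog : Real.log A.card ≤ 100 * x := by
    rw [hxA, Real.log_pow]
    have := Real.log_le_sub_one_of_pos hx0
    push_cast
    linarith
  have hJx : (1080 * J + 1 : ℝ) ≤ 1300000 * x := by
    have h1 : 2 ^ J ≤ 2 * A.card ^ 6 := by
      have h2 : A.card ^ 2 * K ≤ A.card ^ 6 := by
        calc A.card ^ 2 * K ≤ A.card ^ 2 * A.card ^ 4 := Nat.mul_le_mul_left _ hKA
          _ = _ := by ring
      exact (Nat.pow_le_pow_right (by norm_num) (Nat.clog_mono_right 2 h2)).trans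
        (two_pow_clog_le (by positivity))
    have h2 : (2 : ℝ) ^ J ≤ 2 * A.card ^ 6 := by exact_mod_cast h1
    have h3 := Real.log_le_log (by positivity) h2
    rw [Real.log_pow, Real.log_mul (by norm_num) (by positivity), Real.log_pow] at h3
    push_cast at h3
    have h4 : (0.69 : ℝ) < Real.log 2 := by linarith [Real.log_two_gt_d9]
    have h5 : Real.log 2 < 0.7 := by linarith [Real.log_two_lt_d9]
    have h6 : (J : ℝ) * 0.69 ≤ J * Real.log 2 :=
      mul_le_mul_of_nonneg_left h4.le (Nat.cast_nonneg _)
    linarith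
  have hH : 1 + Real.log (A.card ^ 4 : ℕ) ≤ 1000 * x := by
    push_cast
    rw [Real.log_pow]
    push_cast
    linarith
  have hH0 : 0 ≤ 1 + Real.log (A.card ^ 4 : ℕ) := by
    linarith [Real.log_natCast_nonneg (A.card ^ 4)]
  have hM : 76 * (1080 * J + 1 : ℝ) * A.card ^ 3 ≤ 10 ^ 8 * x ^ 301 := by
    rw [hxA]
    calc 76 * (1080 * J + 1 : ℝ) * (x ^ 100) ^ 3 ≤ 76 * (1300000 * x) * (x ^ 100) ^ 3 := by gcongr
      _ = 98800000 * x ^ 301 := by ring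
      _ ≤ _ := mul_le_mul_of_nonneg_right (by norm_num) (by positivity)
  set s := √(K : ℝ) with hs
  have hs2 : s ^ 2 = K := Real.sq_sqrt (Nat.cast_nonneg _)
  have hs0 : 0 ≤ s := Real.sqrt_nonneg _
  have h1 : x ^ 4000 ≤ 2 ^ 26 * (10 ^ 8 * x ^ 301) ^ 9 * s ^ 17 * (1000 * x) ^ 2 := by
    calc x ^ 4000 = (A.card : ℝ) ^ 40 := by rw [hxA, ← pow_mul]
      _ ≤ _ := hmain
      _ ≤ _ := by gcongr
  have h2 : x ^ 1289 ≤ (2 ^ 26 * 10 ^ 78) * s ^ 17 := by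
    refine le_of_mul_le_mul_right ?_ (pow_pos hx0 2711)
    calc x ^ 1289 * x ^ 2711 = x ^ 4000 := by rw [← pow_add]
      _ ≤ _ := h1
      _ = _ := by ring
  have h3 : (x ^ 151) ^ 17 ≤ ((2 ^ 26 * 10 ^ 78) * (K : ℝ)) ^ 17 := by
    calc (x ^ 151) ^ 17 = x ^ 2567 := by rw [← pow_mul]
      _ ≤ x ^ 2578 := pow_le_pow_right₀ hx (by norm_num)
      _ = (x ^ 1289) ^ 2 := by rw [← pow_mul]
      _ ≤ ((2 ^ 26 * 10 ^ 78) * s ^ 17) ^ 2 := pow_le_pow_left₀ (by positivity) h2 2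
      _ = (2 ^ 26 * 10 ^ 78) ^ 2 * (K : ℝ) ^ 17 := by rw [← hs2]; ring
      _ ≤ (2 ^ 26 * 10 ^ 78) ^ 17 * (K : ℝ) ^ 17 :=
        mul_le_mul_of_nonneg_right (by norm_num) (by positivity)
      _ = _ := by rw [← mul_pow]
  exact (pow_le_pow_iff_left₀ (by positivity) (by positivity) (by norm_num)).1 h3

/-- For every `ε > 0` there exist `c_ε > 0` and `c > 0` such that for every prime `p` and
`A ⊆ 𝔽_p` with `|A| ≤ c·p^{71/125}`, one has
`|(A-A)² - (A-A)²| ≥ c_ε·p^{-ε}·|A|^{3/2 + 1/142}`. -/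
theorem diff_sq_diff_lower (ε : ℝ) (hε : 0 < ε) :
    ∃ cε c : ℝ, 0 < cε ∧ 0 < c ∧
      ∀ (p : ℕ), p.Prime →
        ∀ A : Finset (ZMod p), (A.card : ℝ) ≤ c * (p : ℝ) ^ ((71 : ℝ) / 125) →
          cε * (p : ℝ) ^ (-ε) * (A.card : ℝ) ^ ((3 : ℝ) / 2 + 1 / 142) ≤
            ((((A - A).image fun x => x ^ 2) - ((A - A).image fun x => x ^ 2)).card : ℝ) := by
  refine ⟨(2 ^ 26 * 10 ^ 78)⁻¹, 1 / 8, by positivity, by norm_num, fun p hp A hA => ?_⟩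
  have : Fact p.Prime := ⟨hp⟩
  have hexp : (3 : ℝ) / 2 + 1 / 142 = 107 / 71 := by norm_num
  rw [hexp]
  have hp1 : (1 : ℝ) ≤ p := by exact_mod_cast hp.one_lt.le
  have hpε : (p : ℝ) ^ (-ε) ≤ 1 := Real.rpow_le_one_of_one_le_of_nonpos hp1 (by linarith)
  have hpε0 : 0 ≤ (p : ℝ) ^ (-ε) := Real.rpow_nonneg (by linarith) _
  obtain ⟨K, hK⟩ : ∃ K, K =
    (((A - A).image fun x => x ^ 2) - ((A - A).image fun x => x ^ 2)).card := ⟨_, rfl⟩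
  rw [← hK]
  obtain ⟨N, hN⟩ : ∃ N : ℝ, N = (A.card : ℝ) := ⟨_, rfl⟩
  rw [← hN] at hA ⊢
  have hN0 : 0 ≤ N := hN ▸ Nat.cast_nonneg _
  suffices h : (2 ^ 26 * 10 ^ 78 : ℝ)⁻¹ * N ^ ((107 : ℝ) / 71) ≤ K by
    refine le_trans ?_ h
    calc (2 ^ 26 * 10 ^ 78 : ℝ)⁻¹ * (p : ℝ) ^ (-ε) * N ^ ((107 : ℝ) / 71)
        ≤ (2 ^ 26 * 10 ^ 78 : ℝ)⁻¹ * 1 * N ^ ((107 : ℝ) / 71) := by gcongr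
      _ = _ := by rw [mul_one]
  rcases Nat.eq_zero_or_pos A.card with hA0 | hA0
  · have : N = 0 := by rw [hN, hA0, Nat.cast_zero]
    rw [this, Real.zero_rpow (by norm_num), mul_zero]
    exact Nat.cast_nonneg _
  have hN1 : 1 ≤ N := by rw [hN]; exact_mod_cast hA0
  rcases le_or_gt (N ^ ((107 : ℝ) / 71)) K with hle | hlt
  · refine le_trans ?_ hle
    exact mul_le_of_le_one_left (Real.rpow_nonneg hN0 _) (inv_le_one_of_one_le₀ (by norm_num))
  have hp8 : (8 : ℝ) ≤ p := by
    have h1 : (p : ℝ) ^ ((71 : ℝ) / 125) ≤ (p : ℝ) ^ (1 : ℝ) :=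
      Real.rpow_le_rpow_of_exponent_le hp1 (by norm_num)
    rw [Real.rpow_one] at h1
    linarith
  have hp2 : p ≠ 2 := by
    rintro rfl
    norm_num at hp8
  have hpow : 216 * (A.card ^ 2 * K) < p ^ 2 := by
    have h1 : N ^ 2 * K ≤ N ^ ((249 : ℝ) / 71) := by
      calc N ^ 2 * K ≤ N ^ 2 * N ^ ((107 : ℝ) / 71) := by gcongr
        _ = N ^ ((249 : ℝ) / 71) := by
          rw [← Real.rpow_natCast, ← Real.rpow_add (by linarith)]
          norm_num
    have h2 : N ^ ((249 : ℝ) / 71) ≤ (1 / 8 * (p : ℝ) ^ ((71 : ℝ) / 125)) ^ ((249 : ℝ) / 71) :=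
      Real.rpow_le_rpow hN0 hA (by norm_num)
    rw [Real.mul_rpow (by norm_num) (by positivity), ← Real.rpow_mul (by linarith)] at h2
    have h3 : (1 / 8 : ℝ) ^ ((249 : ℝ) / 71) ≤ (1 / 8 : ℝ) ^ (3 : ℝ) :=
      Real.rpow_le_rpow_of_exponent_ge (by norm_num) (by norm_num) (by norm_num)
    have h4 : (p : ℝ) ^ ((71 : ℝ) / 125 * (249 / 71)) ≤ (p : ℝ) ^ (2 : ℝ) :=
      Real.rpow_le_rpow_of_exponent_le hp1 (by norm_num)
    have h5 : (1 / 8 : ℝ) ^ (3 : ℝ) = 1 / 512 := by norm_num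
    rw [h5] at h3
    rw [Real.rpow_two] at h4
    have h6 := h1.trans (h2.trans (mul_le_mul h3 h4 (by positivity) (by norm_num)))
    have h7 : 216 * (N ^ 2 * K) < (p : ℝ) ^ 2 := by nlinarith
    rw [hN] at h7
    exact_mod_cast h7
  have hKA : K ≤ A.card ^ 4 := by
    have h1 : N ^ ((107 : ℝ) / 71) ≤ N ^ (4 : ℝ) :=
      Real.rpow_le_rpow_of_exponent_le hN1 (by norm_num)
    have h2 : N ^ (4 : ℝ) = N ^ (4 : ℕ) := by
      rw [← Real.rpow_natCast N 4]
      norm_num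
    have h3 : (K : ℝ) ≤ N ^ (4 : ℕ) := by
      rw [← h2]
      exact hlt.le.trans h1
    rw [hN] at h3
    exact_mod_cast h3
  set x : ℝ := N ^ ((1 : ℝ) / 100) with hx
  have hx1 : 1 ≤ x := Real.one_le_rpow hN1 (by norm_num)
  have hxN : N = x ^ 100 := by
    rw [hx, ← Real.rpow_natCast, ← Real.rpow_mul hN0]
    norm_num
  have hmain := pow_card_le_mul_card p hp2 A hA0 K hK hpow hKA hx1 (hN ▸ hxN)
  have hlast : N ^ ((107 : ℝ) / 71) ≤ x ^ 151 := by
    rw [hx, ← Real.rpow_natCast, ← Real.rpow_mul hN0]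
    exact Real.rpow_le_rpow_of_exponent_le hN1 (by norm_num)
  rw [inv_mul_le_iff₀ (by positivity)]
  exact hlast.trans hmain

end FpSumProd
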